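/- arXiv:1902.08582 — 2 statements merged into one kernel-verified Lean document; each statement's English description precedes it below -/
import Mathlib

section
/- Let ρ = e^{−V} be a probability density on ℝⁿ with V : ℝⁿ → ℝ convex, let δ > 0, and let m_δ be the unique point satisfying ∫ x e^{−δ|x−m_δ|²/2} ρ(x) dx = m_δ ∫ e^{−δ|x−m_δ|²/2} ρ(x) dx. Then the map m ↦ ∫_{ℝⁿ} e^{−δ|x−m|²/2} ρ(x) dx attains a unique global maximum at m = m_δ (i.e., its value at any m ≠ m_δ is strictly smaller). -/
open MeasureTheory

open Set Filter Topology
open scoped ENNReal NNReal Pointwise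

theorem Real.volume_add_le_volume_add_of_isCompact {K L : Set ℝ} (hK : IsCompact K)
    (hL : IsCompact L) (hK' : K.Nonempty) (hL' : L.Nonempty) :
    volume K + volume L ≤ volume (K + L) := by
  obtain ⟨a, haK, ha⟩ := hK.exists_isGreatest hK'
  obtain ⟨b, hbL, hb⟩ := hL.exists_isLeast hL'
  have hdisj : AEDisjoint volume ((fun x => x + b) '' K) ((fun x => a + x) '' L) := by
    refine measure_mono_null (t := {a + b}) ?_ (by simp)
    rintro _ ⟨⟨x, hx, rfl⟩, ⟨y, hy, hxy⟩⟩
    have h1 := ha hx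
    have h2 := hb hy
    simp only [mem_singleton_iff] at *
    linarith
  have hmeas : MeasurableSet ((fun x => a + x) '' L) :=
    (hL.image (by fun_prop)).measurableSet
  calc volume K + volume L
      = volume ((fun x => x + b) '' K) + volume ((fun x => a + x) '' L) := by
        simp
    _ = volume (((fun x => x + b) '' K) ∪ ((fun x => a + x) '' L)) :=
        (measure_union₀ hmeas.nullMeasurableSet hdisj).symm
    _ ≤ volume (K + L) := by
        refine measure_mono (union_subset ?_ ?_)
        · rintro _ ⟨x, hx, rfl⟩
          exact add_mem_add hx hbL
        · rintro _ ⟨x, hx, rfl⟩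
          exact add_mem_add haK hx

/-- The one-dimensional Brunn–Minkowski inequality. -/
theorem Real.volume_add_le_volume_add {A B : Set ℝ} (hA : MeasurableSet A)
    (hB : MeasurableSet B) (hA' : A.Nonempty) (hB' : B.Nonempty) :
    volume A + volume B ≤ volume (A + B) := by
  obtain ⟨a, ha⟩ := hA'
  obtain ⟨b, hb⟩ := hB'
  rw [hA.measure_eq_iSup_isCompact, hB.measure_eq_iSup_isCompact]
  simp only [iSup_and']
  refine ENNReal.biSup_add_biSup_le' ⟨∅, by simp⟩ ⟨∅, by simp⟩ fun K hK L hL => ?_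
  calc volume K + volume L ≤ volume (insert a K) + volume (insert b L) :=
        add_le_add (measure_mono (subset_insert _ _)) (measure_mono (subset_insert _ _))
    _ ≤ volume (insert a K + insert b L) :=
        Real.volume_add_le_volume_add_of_isCompact (hK.2.insert a) (hL.2.insert b)
          (insert_nonempty _ _) (insert_nonempty _ _)
    _ ≤ volume (A + B) := by
        gcongr
        · exact insert_subset ha hK.1
        · exact insert_subset hb hL.1

/-- The Prékopa–Leindler inequality at the midpoint, as a property of a measure space. -/
def IsPrekopaLeindler (E : Type*) [AddCommGroup E] [Module ℝ E] [MeasureSpace E] : Prop :=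
  ∀ f g k : E → ℝ≥0∞, Measurable f → Measurable g → Measurable k →
    (∀ x y, f x * g y ≤ k ((1 / 2 : ℝ) • (x + y)) ^ 2) →
      (∫⁻ x, f x) * (∫⁻ x, g x) ≤ (∫⁻ x, k x) ^ 2

theorem IsPrekopaLeindler.prod {E F : Type*} [AddCommGroup E] [Module ℝ E] [MeasureSpace E]
    [AddCommGroup F] [Module ℝ F] [MeasureSpace F] [SFinite (volume : Measure F)]
    (hE : IsPrekopaLeindler E) (hF : IsPrekopaLeindler F) : IsPrekopaLeindler (E × F) := by
  intro f g k hf hg hk h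
  have hprod : (volume : Measure (E × F)) = (volume : Measure E).prod volume := rfl
  rw [hprod, lintegral_prod _ hf.aemeasurable, lintegral_prod _ hg.aemeasurable,
    lintegral_prod _ hk.aemeasurable]
  refine hE _ _ _ hf.lintegral_prod_right' hg.lintegral_prod_right' hk.lintegral_prod_right'
    fun x x' => ?_
  exact hF _ _ _ (by fun_prop) (by fun_prop) (by fun_prop) fun y y' => h (x, y) (x', y')

theorem IsPrekopaLeindler.of_measurePreserving {E F : Type*} [AddCommGroup E] [Module ℝ E]
    [MeasureSpace E] [AddCommGroup F] [Module ℝ F] [MeasureSpace F] (e : E →ₗ[ℝ] F)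
    (he : MeasurePreserving e)  (hE : IsPrekopaLeindler E) : IsPrekopaLeindler F := by
  intro f g k hf hg hk h
  rw [← he.lintegral_comp hf, ← he.lintegral_comp hg, ← he.lintegral_comp hk]
  refine hE _ _ _ (hf.comp he.measurable) (hg.comp he.measurable) (hk.comp he.measurable)
    fun x y => ?_
  simpa using h (e x) (e y)

theorem isPrekopaLeindler_of_unique {E : Type*} [AddCommGroup E] [Module ℝ E] [MeasureSpace E]
    [Unique E] (h1 : volume (univ : Set E) = 1) : IsPrekopaLeindler E := by
  intro f g k _ _ _ h
  simp only [lintegral_unique, h1, mul_one]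
  exact (h default default).trans_eq (by rw [Unique.eq_default ((1 / 2 : ℝ) • _)])

theorem lintegral_add_lintegral_le_of_le_one {f g k : ℝ → ℝ} (hf : Measurable f)
    (hg : Measurable g) (hk : Measurable k) (hf0 : 0 ≤ f) (hg0 : 0 ≤ g) (hk0 : 0 ≤ k)
    (hf1 : ∀ x, f x ≤ 1) (hg1 : ∀ x, g x ≤ 1)
    (hf1' : ∀ t, 0 < t → t < 1 → ∃ x, t < f x) (hg1' : ∀ t, 0 < t → t < 1 → ∃ x, t < g x)
    (h : ∀ x y, f x * g y ≤ k ((1 / 2 : ℝ) • (x + y)) ^ 2) :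
    (∫⁻ x, ENNReal.ofReal (f x)) + (∫⁻ x, ENNReal.ofReal (g x)) ≤
      2 * ∫⁻ x, ENNReal.ofReal (k x) := by
  have hlt : ∀ {u : ℝ → ℝ}, Measurable u → ∀ t, MeasurableSet {x | t < u x} :=
    fun hu t => measurableSet_lt measurable_const hu
  rw [lintegral_eq_lintegral_meas_lt _ (.of_forall hf0) hf.aemeasurable,
    lintegral_eq_lintegral_meas_lt _ (.of_forall hg0) hg.aemeasurable,
    lintegral_eq_lintegral_meas_lt _ (.of_forall hk0) hk.aemeasurable,
    ← lintegral_const_mul' _ _ (by simp), ← lintegral_add_left]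
  swap
  · exact Antitone.measurable fun s t hst => measure_mono fun x hx => lt_of_le_of_lt hst hx
  refine setLIntegral_mono' measurableSet_Ioi fun t ht => ?_
  rcases lt_or_ge t 1 with ht1 | ht1
  · refine (Real.volume_add_le_volume_add (hlt hf t) (hlt hg t) (hf1' t ht ht1)
      (hg1' t ht ht1)).trans ?_
    have hsub : {x | t < f x} + {x | t < g x} ⊆ (2 : ℝ) • {x | t < k x} := by
      rintro _ ⟨x, hx, y, hy, rfl⟩
      refine ⟨(1 / 2 : ℝ) • (x + y), ?_, by simp⟩
      have hlt2 : t ^ 2 < k ((1 / 2 : ℝ) • (x + y)) ^ 2 := by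
        refine lt_of_lt_of_le ?_ (h x y)
        rw [sq]
        exact mul_lt_mul'' hx hy (le_of_lt ht) (le_of_lt ht)
      exact lt_of_pow_lt_pow_left₀ 2 (hk0 _) hlt2
    refine (measure_mono hsub).trans ?_
    rw [Measure.addHaar_smul]
    simp
  · have h0 : ∀ {u : ℝ → ℝ}, (∀ x, u x ≤ 1) → {x | t < u x} = ∅ := fun hu =>
      eq_empty_of_forall_notMem fun x hx => absurd (lt_of_lt_of_le hx (hu x)) (not_lt.2 ht1)
    simp [h0 hf1, h0 hg1]

theorem ENNReal.mul_le_sq_of_add_le_two_mul {a b c : ℝ≥0∞} (h : a + b ≤ 2 * c) :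
    a * b ≤ c ^ 2 := by
  rcases eq_or_ne c ⊤ with rfl | hc
  · simp
  have hab : a + b ≠ ⊤ := ne_top_of_le_ne_top (by finiteness) h
  lift c to ℝ≥0 using hc
  lift a to ℝ≥0 using (ENNReal.add_ne_top.1 hab).1
  lift b to ℝ≥0 using (ENNReal.add_ne_top.1 hab).2
  norm_cast at h ⊢
  have h' : (a : ℝ) + b ≤ 2 * c := by exact_mod_cast h
  have : (a : ℝ) * b ≤ c ^ 2 := by
    nlinarith [sq_nonneg ((a : ℝ) - b), a.coe_nonneg, b.coe_nonneg, c.coe_nonneg]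
  exact_mod_cast this

theorem lintegral_mul_lintegral_le_of_iSup_eq_one {f g k : ℝ → ℝ≥0∞} (hf : Measurable f)
    (hg : Measurable g) (hk : Measurable k) (hf1 : ⨆ x, f x = 1) (hg1 : ⨆ x, g x = 1)
    (h : ∀ x y, f x * g y ≤ k ((1 / 2 : ℝ) • (x + y)) ^ 2) :
    (∫⁻ x, f x) * (∫⁻ x, g x) ≤ (∫⁻ x, k x) ^ 2 := by
  have hle : ∀ {u : ℝ → ℝ≥0∞}, ⨆ x, u x = 1 → ∀ x, u x ≤ 1 := fun hu x => hu ▸ le_iSup _ x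
  have hex : ∀ {u : ℝ → ℝ≥0∞}, ⨆ x, u x = 1 →
      ∀ t : ℝ, 0 < t → t < 1 → ∃ x, t < (u x).toReal := by
    intro u hu t ht0 ht1
    obtain ⟨x, hx⟩ := lt_iSup_iff.1 (hu ▸ ENNReal.ofReal_lt_one.2 ht1 : ENNReal.ofReal t < ⨆ x, u x)
    exact ⟨x, (ENNReal.ofReal_lt_iff_lt_toReal ht0.le
      (ne_top_of_le_ne_top ENNReal.one_ne_top (hle hu x))).1 hx⟩
  have htop : ∀ {a : ℝ≥0∞}, a ≤ 1 → a ≠ ⊤ := fun ha => ne_top_of_le_ne_top ENNReal.one_ne_top ha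
  have hreal : ∀ {a : ℝ≥0∞}, a ≤ 1 → a.toReal ≤ 1 := fun ha =>
    (ENNReal.toReal_mono ENNReal.one_ne_top ha).trans_eq (by simp)
  have key := lintegral_add_lintegral_le_of_le_one (f := fun x => (f x).toReal)
    (g := fun x => (g x).toReal) (k := fun x => (min (k x) 1).toReal)
    (by fun_prop) (by fun_prop) (by fun_prop) (fun _ => ENNReal.toReal_nonneg)
    (fun _ => ENNReal.toReal_nonneg) (fun _ => ENNReal.toReal_nonneg)
    (fun x => hreal (hle hf1 x)) (fun x => hreal (hle hg1 x)) (hex hf1) (hex hg1) ?_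
  · simp only [ENNReal.ofReal_toReal (htop (hle hf1 _)), ENNReal.ofReal_toReal (htop (hle hg1 _)),
      ENNReal.ofReal_toReal (htop (min_le_right _ (1 : ℝ≥0∞)))] at key
    refine (ENNReal.mul_le_sq_of_add_le_two_mul key).trans ?_
    gcongr
    exact min_le_left _ _
  · intro x y
    simp only [← ENNReal.toReal_mul, ← ENNReal.toReal_pow]
    refine ENNReal.toReal_mono (ENNReal.pow_ne_top (htop (min_le_right _ _))) ?_
    rcases le_total (k ((1 / 2 : ℝ) • (x + y))) 1 with h1 | h1
    · rw [min_eq_left h1]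
      exact h x y
    · rw [min_eq_right h1, one_pow]
      exact mul_le_one' (hle hf1 x) (hle hg1 y)

theorem ENNReal.exists_mul_sq_eq_one {M : ℝ≥0∞} (h0 : M ≠ 0) (ht : M ≠ ⊤) :
    ∃ c : ℝ≥0∞, c ≠ 0 ∧ c ≠ ⊤ ∧ c ^ 2 * M = 1 := by
  refine ⟨(M ^ (1 / 2 : ℝ))⁻¹, by simp [ht], by simp [h0], ?_⟩
  rw [← ENNReal.inv_pow, ← ENNReal.rpow_natCast, ← ENNReal.rpow_mul]
  simpa using ENNReal.inv_mul_cancel h0 ht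

theorem lintegral_mul_lintegral_le_of_bounded {f g k : ℝ → ℝ≥0∞} (hf : Measurable f)
    (hg : Measurable g) (hk : Measurable k) (hfb : ⨆ x, f x ≠ ⊤) (hgb : ⨆ x, g x ≠ ⊤)
    (h : ∀ x y, f x * g y ≤ k ((1 / 2 : ℝ) • (x + y)) ^ 2) :
    (∫⁻ x, f x) * (∫⁻ x, g x) ≤ (∫⁻ x, k x) ^ 2 := by
  rcases eq_or_ne (⨆ x, f x) 0 with hf0 | hf0
  · simp only [ENNReal.iSup_eq_zero] at hf0
    simp [hf0]
  rcases eq_or_ne (⨆ x, g x) 0 with hg0 | hg0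
  · simp only [ENNReal.iSup_eq_zero] at hg0
    simp [hg0]
  obtain ⟨a, ha0, hat, ha⟩ := ENNReal.exists_mul_sq_eq_one hf0 hfb
  obtain ⟨b, hb0, hbt, hb⟩ := ENNReal.exists_mul_sq_eq_one hg0 hgb
  have key := lintegral_mul_lintegral_le_of_iSup_eq_one (hf.const_mul (a ^ 2))
    (hg.const_mul (b ^ 2)) (hk.const_mul (a * b)) (by rw [← ENNReal.mul_iSup, ha])
    (by rw [← ENNReal.mul_iSup, hb]) fun x y => by
      calc a ^ 2 * f x * (b ^ 2 * g y) = (a * b) ^ 2 * (f x * g y) := by ring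
        _ ≤ (a * b) ^ 2 * k ((1 / 2 : ℝ) • (x + y)) ^ 2 := by gcongr; exact h x y
        _ = _ := by ring
  rw [lintegral_const_mul _ hf, lintegral_const_mul _ hg, lintegral_const_mul _ hk] at key
  rw [← ENNReal.mul_le_mul_iff_right (a := (a * b) ^ 2) (by simp [ha0, hb0]) (by finiteness)]
  convert key using 1 <;> ring

theorem isPrekopaLeindler_real : IsPrekopaLeindler ℝ := by
  intro f g k hf hg hk h
  have hsup : ∀ {u : ℝ → ℝ≥0∞}, Measurable u →
      ∫⁻ x, u x = ⨆ i : ℕ, ∫⁻ x, min (u x) i := by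
    intro u hu
    rw [← lintegral_iSup (f := fun (i : ℕ) x => min (u x) i) (fun i => by fun_prop)
      fun i j hij x => min_le_min_left _ (by exact_mod_cast hij)]
    refine lintegral_congr fun x => ?_
    change _ = ⨆ i : ℕ, u x ⊓ (i : ℝ≥0∞)
    rw [← inf_iSup_eq, ENNReal.iSup_natCast, inf_top_eq]
  have hb : ∀ (u : ℝ → ℝ≥0∞) (i : ℕ), ⨆ x, min (u x) i ≠ ⊤ := fun u i =>
    ne_top_of_le_ne_top (ENNReal.natCast_ne_top i) (iSup_le fun _ => min_le_right _ _)
  rw [hsup hf, hsup hg]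
  simp only [ENNReal.iSup_mul, ENNReal.mul_iSup, iSup_le_iff]
  intro i j
  refine lintegral_mul_lintegral_le_of_bounded (by fun_prop) (by fun_prop) hk (hb _ _) (hb _ _)
    fun x y => le_trans ?_ (h x y)
  gcongr <;> exact min_le_left _ _

theorem isPrekopaLeindler_pi (n : ℕ) : IsPrekopaLeindler (Fin n → ℝ) := by
  induction n with
  | zero => exact isPrekopaLeindler_of_unique (by rw [volume_pi, Measure.pi_of_empty]; simp)
  | succ n ih =>
    refine (isPrekopaLeindler_real.prod ih).of_measurePreserving
      (Fin.consLinearEquiv ℝ fun _ : Fin (n + 1) => ℝ).toLinearMap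
      ?_
    have hcons : ⇑(Fin.consLinearEquiv ℝ fun _ : Fin (n + 1) => ℝ).toLinearMap =
        ⇑(MeasurableEquiv.piFinSuccAbove (fun _ : Fin (n + 1) => ℝ) 0).symm := by
      ext x i
      refine Fin.cases ?_ (fun j => ?_) i <;> simp
    rw [hcons]
    exact (volume_preserving_piFinSuccAbove (fun _ : Fin (n + 1) => ℝ) 0).symm _

/-- The Prékopa–Leindler inequality. -/
theorem isPrekopaLeindler_euclideanSpace (n : ℕ) : IsPrekopaLeindler (EuclideanSpace ℝ (Fin n)) :=
  (isPrekopaLeindler_pi n).of_measurePreserving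
    (WithLp.linearEquiv 2 ℝ (Fin n → ℝ)).symm.toLinearMap (PiLp.volume_preserving_toLp (Fin n))

theorem lt_of_midpoint_log_concave {φ : ℝ → ℝ} (hpos : ∀ t, 0 < φ t)
    (han : AnalyticOnNhd ℝ φ univ) (hd : HasDerivAt φ 0 0)
    (hmid : ∀ s t, φ s * φ t ≤ φ ((s + t) / 2) ^ 2) (hlim : Tendsto φ atTop (𝓝 0)) :
    φ 1 < φ 0 := by
  by_contra! hle
  set ψ : ℝ → ℝ := fun t => Real.log (φ t) - Real.log (φ 0) with hψ
  have hhalf : ∀ t, ψ t ≤ 2 * ψ (t / 2) := by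
    intro t
    have h := Real.log_le_log (mul_pos (hpos 0) (hpos t)) (hmid 0 t)
    rw [Real.log_mul (hpos 0).ne' (hpos t).ne', Real.log_pow, zero_add] at h
    push_cast at h
    simp only [hψ]
    linarith
  have hpow : ∀ t (n : ℕ), ψ t ≤ 2 ^ n * ψ (t / 2 ^ n) := by
    intro t n
    induction n with
    | zero => simp
    | succ n ih =>
      have h := hhalf (t / 2 ^ n)
      rw [div_div, ← pow_succ] at h
      calc ψ t ≤ 2 ^ n * ψ (t / 2 ^ n) := ih
        _ ≤ 2 ^ n * (2 * ψ (t / 2 ^ (n + 1))) := by gcongr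
        _ = _ := by ring
  have hψd : HasDerivAt ψ 0 0 := by
    have h := (hd.log (hpos 0).ne').sub_const (Real.log (φ 0))
    rwa [zero_div] at h
  have htend : ∀ t : ℝ, Tendsto (fun n : ℕ => t / 2 ^ n) atTop (𝓝 0) := fun t => by
    simpa [div_eq_mul_inv] using
      (tendsto_pow_atTop_nhds_zero_of_lt_one (r := (2 : ℝ)⁻¹) (by norm_num)
        (by norm_num)).const_mul t
  have hnonpos : ∀ t, ψ t ≤ 0 := by
    intro t
    rcases eq_or_ne t 0 with rfl | ht
    · simp [hψ]
    have hsl := (hasDerivAt_iff_tendsto_slope_zero.1 hψd).comp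
      (tendsto_nhdsWithin_iff.2 ⟨htend t, .of_forall fun n => by
        simp [ht]⟩)
    have hsl' := hsl.const_mul t
    rw [mul_zero] at hsl'
    refine ge_of_tendsto hsl' (.of_forall fun n => (hpow t n).trans_eq ?_)
    simp only [Function.comp, zero_add, smul_eq_mul]
    have : ψ 0 = 0 := by simp [hψ]
    rw [this]
    field_simp
    ring
  have hone : 0 ≤ ψ 1 := sub_nonneg.2 (Real.log_le_log (hpos 0) hle)
  have hzero : ∀ n : ℕ, φ (1 / 2 ^ n) = φ 0 := by
    intro n
    have h1 : 0 ≤ ψ (1 / 2 ^ n) :=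
      nonneg_of_mul_nonneg_right (hone.trans (hpow 1 n)) (by positivity)
    have h2 : ψ (1 / 2 ^ n) = 0 := le_antisymm (hnonpos _) h1
    exact Real.log_injOn_pos (hpos _) (hpos _) (sub_eq_zero.1 h2)
  have hfreq : ∃ᶠ t in 𝓝[≠] (0 : ℝ), φ t = φ 0 :=
    (tendsto_nhdsWithin_iff.2 ⟨htend 1, .of_forall fun n => by simp⟩).frequently
      (.of_forall hzero)
  have hconst : φ = fun _ => φ 0 := han.eq_of_frequently_eq analyticOnNhd_const hfreq
  rw [hconst] at hlim
  exact (hpos 0).ne' (tendsto_nhds_unique tendsto_const_nhds hlim)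

section ReweightedMass

variable {n : ℕ} {V : EuclideanSpace ℝ (Fin n) → ℝ} {δ : ℝ}

theorem exp_neg_mul_sq_le_one (hδ : 0 < δ) (r : ℝ) : Real.exp (-(δ * r ^ 2 / 2)) ≤ 1 :=
  Real.exp_le_one_iff.2 (neg_nonpos.2 (by positivity))

theorem integrable_gaussian_mul_exp_neg (hVint : Integrable fun x => Real.exp (-V x))
    (hδ : 0 < δ) (m : EuclideanSpace ℝ (Fin n)) :
    Integrable fun x => Real.exp (-(δ * ‖x - m‖ ^ 2 / 2)) * Real.exp (-V x) := by
  refine hVint.bdd_mul (c := 1) (by fun_prop) (.of_forall fun x => ?_)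
  rw [Real.norm_of_nonneg (Real.exp_pos _).le]
  exact exp_neg_mul_sq_le_one hδ _

theorem mul_exp_neg_mul_sq_le (hδ : 0 < δ) {r : ℝ} :
    r * Real.exp (-(δ * r ^ 2 / 2)) ≤ 1 + 2 / δ := by
  rw [Real.exp_neg, ← div_eq_mul_inv, div_le_iff₀ (Real.exp_pos _)]
  have h1 := Real.add_one_le_exp (δ * r ^ 2 / 2)
  have h2 : 1 + r ^ 2 ≤ (1 + 2 / δ) * (δ * r ^ 2 / 2 + 1) := by
    have : (1 + 2 / δ) * (δ * r ^ 2 / 2 + 1) = 1 + r ^ 2 + (δ * r ^ 2 / 2 + 2 / δ) := by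
      field_simp
      ring
    rw [this]
    have : 0 ≤ δ * r ^ 2 / 2 + 2 / δ := by positivity
    linarith
  have h3 : (1 + 2 / δ) * (δ * r ^ 2 / 2 + 1) ≤ (1 + 2 / δ) * Real.exp (δ * r ^ 2 / 2) := by
    gcongr
  nlinarith [sq_nonneg (r - 1)]

theorem integrable_gaussian_mul_exp_neg_smul_sub (hVc : Continuous V)
    (hVint : Integrable fun x => Real.exp (-V x)) (hδ : 0 < δ) (m : EuclideanSpace ℝ (Fin n)) :
    Integrable fun x =>
      (Real.exp (-(δ * ‖x - m‖ ^ 2 / 2)) * Real.exp (-V x)) • (x - m) := by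
  refine (hVint.const_mul (1 + 2 / δ)).mono' (by fun_prop) (.of_forall fun x => ?_)
  rw [norm_smul, Real.norm_of_nonneg (by positivity)]
  calc _ = ‖x - m‖ * Real.exp (-(δ * ‖x - m‖ ^ 2 / 2)) * Real.exp (-V x) := by ring
    _ ≤ _ := by
      gcongr
      exact mul_exp_neg_mul_sq_le hδ

theorem gaussian_mul_exp_neg_midpoint (hV : ConvexOn ℝ univ V) (hδ : 0 < δ)
    (a b x y : EuclideanSpace ℝ (Fin n)) :
    (Real.exp (-(δ * ‖x - a‖ ^ 2 / 2)) * Real.exp (-V x)) *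
        (Real.exp (-(δ * ‖y - b‖ ^ 2 / 2)) * Real.exp (-V y)) ≤
      (Real.exp (-(δ * ‖(1 / 2 : ℝ) • (x + y) - (1 / 2 : ℝ) • (a + b)‖ ^ 2 / 2)) *
        Real.exp (-V ((1 / 2 : ℝ) • (x + y)))) ^ 2 := by
  rw [← Real.exp_add, ← Real.exp_add, ← Real.exp_add, ← Real.exp_add, ← Real.exp_nat_mul,
    Real.exp_le_exp]
  have h1 : V ((1 / 2 : ℝ) • (x + y)) ≤ (1 / 2) * V x + (1 / 2) * V y := by
    simpa [smul_add] using
      hV.2 (mem_univ x) (mem_univ y) (by norm_num : (0 : ℝ) ≤ 1 / 2) (by norm_num) (by norm_num)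
  have h2 : ‖(1 / 2 : ℝ) • (x + y) - (1 / 2 : ℝ) • (a + b)‖ ^ 2 ≤
      (1 / 2) * (‖x - a‖ ^ 2 + ‖y - b‖ ^ 2) := by
    have h3 : (1 / 2 : ℝ) • (x + y) - (1 / 2 : ℝ) • (a + b) =
        (1 / 2 : ℝ) • ((x - a) + (y - b)) := by module
    rw [h3, norm_smul, mul_pow]
    have := parallelogram_law_with_norm ℝ (x - a) (y - b)
    norm_num
    nlinarith [sq_nonneg ‖x - a - (y - b)‖]
  push_cast
  nlinarith [mul_le_mul_of_nonneg_left h2 hδ.le]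

theorem integral_gaussian_mul_exp_neg_midpoint (hV : ConvexOn ℝ univ V) (hVc : Continuous V)
    (hVint : Integrable fun x => Real.exp (-V x)) (hδ : 0 < δ) (a b : EuclideanSpace ℝ (Fin n)) :
    (∫ x, Real.exp (-(δ * ‖x - a‖ ^ 2 / 2)) * Real.exp (-V x)) *
        (∫ x, Real.exp (-(δ * ‖x - b‖ ^ 2 / 2)) * Real.exp (-V x)) ≤
      (∫ x, Real.exp (-(δ * ‖x - (1 / 2 : ℝ) • (a + b)‖ ^ 2 / 2)) * Real.exp (-V x)) ^ 2 := by
  have hmeas : ∀ c : EuclideanSpace ℝ (Fin n), Measurable fun x =>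
      ENNReal.ofReal (Real.exp (-(δ * ‖x - c‖ ^ 2 / 2)) * Real.exp (-V x)) := fun c =>
    ENNReal.measurable_ofReal.comp (by fun_prop : Continuous _).measurable
  have hpos : ∀ c x : EuclideanSpace ℝ (Fin n),
      0 ≤ Real.exp (-(δ * ‖x - c‖ ^ 2 / 2)) * Real.exp (-V x) := fun c x => by positivity
  have key := isPrekopaLeindler_euclideanSpace n _ _ _ (hmeas a) (hmeas b)
    (hmeas ((1 / 2 : ℝ) • (a + b))) fun x y => by
      rw [← ENNReal.ofReal_mul (hpos _ _), ← ENNReal.ofReal_pow (hpos _ _)]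
      exact ENNReal.ofReal_le_ofReal (gaussian_mul_exp_neg_midpoint hV hδ a b x y)
  have hlint : ∀ c : EuclideanSpace ℝ (Fin n),
      ∫⁻ x, ENNReal.ofReal (Real.exp (-(δ * ‖x - c‖ ^ 2 / 2)) * Real.exp (-V x)) =
        ENNReal.ofReal (∫ x, Real.exp (-(δ * ‖x - c‖ ^ 2 / 2)) * Real.exp (-V x)) := fun c =>
    (ofReal_integral_eq_lintegral_ofReal (integrable_gaussian_mul_exp_neg hVint hδ c)
      (.of_forall (hpos c))).symm
  rw [hlint, hlint, hlint, ← ENNReal.ofReal_mul (integral_nonneg (hpos a)),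
    ← ENNReal.ofReal_pow (integral_nonneg (hpos _))] at key
  exact (ENNReal.ofReal_le_ofReal_iff (by positivity)).1 key

theorem tendsto_integral_gaussian_mul_exp_neg (hVint : Integrable fun x => Real.exp (-V x))
    (hδ : 0 < δ) (a : EuclideanSpace ℝ (Fin n))
    {v : EuclideanSpace ℝ (Fin n)} (hv : v ≠ 0) :
    Tendsto (fun t : ℝ => ∫ x, Real.exp (-(δ * ‖x - (a + t • v)‖ ^ 2 / 2)) * Real.exp (-V x))
      atTop (𝓝 0) := by
  rw [← integral_zero (EuclideanSpace ℝ (Fin n)) ℝ]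
  refine tendsto_integral_filter_of_dominated_convergence (fun x => Real.exp (-V x))
    (.of_forall fun t => (integrable_gaussian_mul_exp_neg hVint hδ _).aestronglyMeasurable)
    (.of_forall fun t => .of_forall fun x => ?_) hVint (.of_forall fun x => ?_)
  · rw [Real.norm_of_nonneg (by positivity)]
    exact mul_le_of_le_one_left (Real.exp_pos _).le (exp_neg_mul_sq_le_one hδ _)
  · have hnorm : Tendsto (fun t : ℝ => ‖x - (a + t • v)‖) atTop atTop := by
      refine tendsto_atTop_mono (f := fun t : ℝ => t * ‖v‖ - ‖x - a‖) (fun t => ?_)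
        (tendsto_atTop_add_const_right _ _ (tendsto_id.atTop_mul_const (norm_pos_iff.2 hv)))
      have h1 : ‖t • v‖ ≤ ‖x - a‖ + ‖x - (a + t • v)‖ := by
        calc ‖t • v‖ = ‖(x - a) - (x - (a + t • v))‖ := by congr 1; abel
          _ ≤ _ := norm_sub_le _ _
      have h2 : t * ‖v‖ ≤ ‖t • v‖ := by
        rw [norm_smul]
        gcongr
        exact le_abs_self t
      linarith
    have hsq : Tendsto (fun t : ℝ => δ * ‖x - (a + t • v)‖ ^ 2 / 2) atTop atTop :=
      (((tendsto_pow_atTop two_ne_zero).comp hnorm).const_mul_atTop hδ).atTop_div_const two_pos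
    simpa using (Real.tendsto_exp_neg_atTop_nhds_zero.comp hsq).mul_const (Real.exp (-V x))

/-- Along a line through `a`, the reweighted mass is a Gaussian factor times a moment generating
function. -/
theorem exists_integral_gaussian_mul_exp_neg_eq_mgf (hVc : Continuous V)
    (hVint : Integrable fun x => Real.exp (-V x)) (hδ : 0 < δ) (a v : EuclideanSpace ℝ (Fin n)) :
    ∃ (μ : Measure (EuclideanSpace ℝ (Fin n))) (X : EuclideanSpace ℝ (Fin n) → ℝ),
      ProbabilityTheory.integrableExpSet X μ = univ ∧
      (∫ x, X x ∂μ = δ * inner ℝ v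
        (∫ x, (Real.exp (-(δ * ‖x - a‖ ^ 2 / 2)) * Real.exp (-V x)) • (x - a))) ∧
      ∀ t : ℝ, ∫ x, Real.exp (-(δ * ‖x - (a + t • v)‖ ^ 2 / 2)) * Real.exp (-V x) =
        Real.exp (-(δ * t ^ 2 * ‖v‖ ^ 2 / 2)) * ProbabilityTheory.mgf X μ t := by
  set w : EuclideanSpace ℝ (Fin n) → ℝ :=
    fun x => Real.exp (-(δ * ‖x - a‖ ^ 2 / 2)) * Real.exp (-V x) with hw
  have hwpos : ∀ x, 0 ≤ w x := fun x => by positivity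
  have hwc : Continuous w := by fun_prop
  have hwm : Measurable fun x => ENNReal.ofReal (w x) :=
    ENNReal.measurable_ofReal.comp hwc.measurable
  have hexp : ∀ (t : ℝ) x, w x * Real.exp (t * (δ * inner ℝ v (x - a))) =
      Real.exp (δ * t ^ 2 * ‖v‖ ^ 2 / 2) *
        (Real.exp (-(δ * ‖x - (a + t • v)‖ ^ 2 / 2)) * Real.exp (-V x)) := by
    intro t x
    simp only [hw, ← Real.exp_add]
    congr 1
    rw [← sub_sub x a, norm_sub_sq_real (x - a), norm_smul, mul_pow, inner_smul_right,
      real_inner_comm, Real.norm_eq_abs, sq_abs]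
    ring
  have hexp' : ∀ t : ℝ, (fun x => w x * Real.exp (t * (δ * inner ℝ v (x - a)))) = _ :=
    fun t => funext (hexp t)
  have hdens : ∀ u : EuclideanSpace ℝ (Fin n) → ℝ,
      ∫ x, u x ∂(volume.withDensity fun x => ENNReal.ofReal (w x)) = ∫ x, w x * u x := by
    intro u
    rw [integral_withDensity_eq_integral_toReal_smul hwm (.of_forall fun _ => ENNReal.ofReal_lt_top)]
    simp [ENNReal.toReal_ofReal (hwpos _)]
  refine ⟨volume.withDensity fun x => ENNReal.ofReal (w x), fun x => δ * inner ℝ v (x - a),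
    eq_univ_of_forall fun t => ?_, ?_, fun t => ?_⟩
  · change Integrable _ _
    rw [integrable_withDensity_iff_integrable_smul' hwm (.of_forall fun _ => ENNReal.ofReal_lt_top)]
    simp only [ENNReal.toReal_ofReal (hwpos _), smul_eq_mul]
    rw [hexp' t]
    exact (integrable_gaussian_mul_exp_neg hVint hδ _).const_mul _
  · rw [hdens, ← integral_inner (integrable_gaussian_mul_exp_neg_smul_sub hVc hVint hδ a),
      ← integral_const_mul]
    refine integral_congr_ae (.of_forall fun x => ?_)
    simp only [inner_smul_right, hw]
    ring
  · rw [ProbabilityTheory.mgf, hdens, hexp' t, integral_const_mul, ← mul_assoc, ← Real.exp_add,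
      neg_add_cancel, Real.exp_zero, one_mul]

end ReweightedMass

/-- **The fixed point is the unique global maximizer.**
For a log-concave probability density `ρ = e^{-V}` on `ℝⁿ`, `δ > 0`, and `m_δ` the fixed
point of the reweighted barycenter map, the function `m ↦ ∫ e^{-δ|x-m|²/2} ρ(x) dx`
attains a unique global maximum at `m = m_δ`. -/
theorem reweighted_mass_unique_max
    {n : ℕ} (V : EuclideanSpace ℝ (Fin n) → ℝ) (hV : ConvexOn ℝ Set.univ V)
    (hρ : (∫ x, Real.exp (-V x)) = 1)
    (δ : ℝ) (hδ : 0 < δ)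
    (mδ : EuclideanSpace ℝ (Fin n))
    (hmδ : (∫ x, (Real.exp (-(δ * ‖x - mδ‖ ^ 2 / 2)) * Real.exp (-V x)) • x) =
      (∫ x, Real.exp (-(δ * ‖x - mδ‖ ^ 2 / 2)) * Real.exp (-V x)) • mδ) :
    ∀ m : EuclideanSpace ℝ (Fin n), m ≠ mδ →
      (∫ x, Real.exp (-(δ * ‖x - m‖ ^ 2 / 2)) * Real.exp (-V x)) <
        ∫ x, Real.exp (-(δ * ‖x - mδ‖ ^ 2 / 2)) * Real.exp (-V x) := by
  intro m hm
  have hVc : Continuous V :=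
    continuousOn_univ.1 (hV.continuousOn isOpen_univ)
  have hVint : Integrable fun x => Real.exp (-V x) :=
    .of_integral_ne_zero (by rw [hρ]; exact one_ne_zero)
  have hsub : ∫ x, (Real.exp (-(δ * ‖x - mδ‖ ^ 2 / 2)) * Real.exp (-V x)) • (x - mδ) = 0 := by
    have hw := integrable_gaussian_mul_exp_neg hVint hδ mδ
    have hwx : Integrable fun x =>
        (Real.exp (-(δ * ‖x - mδ‖ ^ 2 / 2)) * Real.exp (-V x)) • x := by
      refine ((integrable_gaussian_mul_exp_neg_smul_sub hVc hVint hδ mδ).add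
        (hw.smul_const mδ)).congr (.of_forall fun x => ?_)
      simp [← smul_add]
    simp only [smul_sub]
    rw [integral_sub hwx (hw.smul_const mδ), integral_smul_const, hmδ, sub_self]
  obtain ⟨μ, X, hX, hmean, hφ⟩ :=
    exists_integral_gaussian_mul_exp_neg_eq_mgf hVc hVint hδ mδ (m - mδ)
  rw [hsub, inner_zero_right, mul_zero] at hmean
  have hX' : ∀ t, t ∈ interior (ProbabilityTheory.integrableExpSet X μ) := by simp [hX]
  have han : AnalyticOnNhd ℝ (ProbabilityTheory.mgf X μ) univ := fun t _ =>
    ProbabilityTheory.analyticAt_mgf (hX' t)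
  have hd : HasDerivAt (ProbabilityTheory.mgf X μ) 0 0 := by
    simpa [hmean] using ProbabilityTheory.hasDerivAt_mgf (hX' 0)
  set φ : ℝ → ℝ := fun t =>
    ∫ x, Real.exp (-(δ * ‖x - (mδ + t • (m - mδ))‖ ^ 2 / 2)) * Real.exp (-V x) with hφdef
  have hφ' : φ = fun t => Real.exp (-(δ * t ^ 2 * ‖m - mδ‖ ^ 2 / 2)) *
      ProbabilityTheory.mgf X μ t := funext hφ
  have key : φ 1 < φ 0 := by
    refine lt_of_midpoint_log_concave (fun t => ?_) ?_ ?_ (fun s t => ?_)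
      (tendsto_integral_gaussian_mul_exp_neg hVint hδ mδ (sub_ne_zero.2 hm))
    · have h := integrable_gaussian_mul_exp_neg hVint hδ (mδ + t • (m - mδ))
      simp only [hφdef, ← Real.exp_add] at h ⊢
      exact integral_exp_pos h
    · rw [hφ']
      refine AnalyticOnNhd.mul (fun t _ => ?_) han
      fun_prop
    · rw [hφ']
      have hg : HasDerivAt (fun t : ℝ => Real.exp (-(δ * t ^ 2 * ‖m - mδ‖ ^ 2 / 2))) 0 0 := by
        have h := (((((hasDerivAt_pow 2 (0 : ℝ)).const_mul δ).mul_const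
          (‖m - mδ‖ ^ 2)).div_const 2).neg).exp
        simpa using h
      have h := hg.mul hd
      rwa [zero_mul, mul_zero, add_zero] at h
    · have h := integral_gaussian_mul_exp_neg_midpoint hV hVc hVint hδ
        (mδ + s • (m - mδ)) (mδ + t • (m - mδ))
      rwa [show (1 / 2 : ℝ) • (mδ + s • (m - mδ) + (mδ + t • (m - mδ))) =
        mδ + ((s + t) / 2) • (m - mδ) by module] at h
  simpa [hφdef] using key
end

section
/- Let ρ = e^{−V} be a probability density on ℝⁿ with V : ℝⁿ → ℝ convex, and for δ > 0 let m_δ be the unique point satisfying ∫ x e^{−δ|x−m_δ|²/2} ρ(x) dx = m_δ ∫ e^{−δ|x−m_δ|²/2} ρ(x) dx. Then the map δ ↦ m_δ is continuous on (0,∞); moreover, for each δ > 0 there exist a neighborhood U_δ of δ and a constant L_δ < ∞ such that |m_{δ'} − m_δ| ≤ L_δ·|δ' − δ| for all δ' ∈ U_δ. -/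
open MeasureTheory

section PrekopaLeindler

open scoped ENNReal Pointwise

theorem volume_add_volume_le_of_compact {A B C : Set ℝ} (hA : IsCompact A) (hB : IsCompact B)
    (hA0 : A.Nonempty) (hB0 : B.Nonempty) {a b : ℝ} (ha : 0 < a) (hb : 0 < b)
    (h : ∀ x ∈ A, ∀ y ∈ B, a * x + b * y ∈ C) :
    ENNReal.ofReal a * volume A + ENNReal.ofReal b * volume B ≤ volume C := by
  obtain ⟨M, hM, hMmax⟩ := hA.exists_isGreatest hA0
  obtain ⟨m, hm, hmmin⟩ := hB.exists_isLeast hB0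
  have hvol : ∀ (c d : ℝ) (S : Set ℝ), 0 < d →
      volume (c +ᵥ (d • S)) = ENNReal.ofReal d * volume S := by
    intro c d S hd
    rw [measure_vadd, Measure.addHaar_smul]
    simp [abs_of_pos hd]
  rw [← hvol (b * m) a A ha, ← hvol (a * M) b B hb, ← measure_union₀]
  · apply measure_mono
    rintro z (hz | hz)
    · obtain ⟨_, ⟨x, hx, rfl⟩, rfl⟩ := hz
      have := h x hx m hm
      simpa [add_comm] using this
    · obtain ⟨_, ⟨x, hx, rfl⟩, rfl⟩ := hz
      have := h M hM x hx
      simpa using this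
  · exact ((hB.smul b).vadd (a * M)).measurableSet.nullMeasurableSet
  · refine measure_mono_null (t := {a * M + b * m}) ?_ (by simp)
    rintro z ⟨hz, hz'⟩
    obtain ⟨_, ⟨x, hx, rfl⟩, rfl⟩ := hz
    obtain ⟨_, ⟨y, hy, rfl⟩, hxy⟩ := hz'
    simp only [smul_eq_mul, vadd_eq_add, Set.mem_singleton_iff] at hxy ⊢
    have h1 := mul_le_mul_of_nonneg_left (hMmax hx) ha.le
    have h2 := mul_le_mul_of_nonneg_left (hmmin hy) hb.le
    linarith

/-- The one-dimensional Brunn–Minkowski inequality. -/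
theorem volume_add_volume_le {A B C : Set ℝ} (hA : MeasurableSet A) (hB : MeasurableSet B)
    (hA0 : A.Nonempty) (hB0 : B.Nonempty) {a b : ℝ} (ha : 0 < a) (hb : 0 < b)
    (h : ∀ x ∈ A, ∀ y ∈ B, a * x + b * y ∈ C) :
    ENNReal.ofReal a * volume A + ENNReal.ofReal b * volume B ≤ volume C := by
  obtain ⟨x₀, hx₀⟩ := hA0
  obtain ⟨y₀, hy₀⟩ := hB0
  have key : ∀ S : Set ℝ, MeasurableSet S →
      volume S = ⨆ K : {K : Set ℝ // K ⊆ S ∧ IsCompact K}, volume K.1 := by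
    intro S hS
    rw [hS.measure_eq_iSup_isCompact, iSup_subtype]
    simp only [iSup_and]
  have : ∀ S : Set ℝ, Nonempty {K : Set ℝ // K ⊆ S ∧ IsCompact K} :=
    fun S => ⟨⟨∅, by simp⟩⟩
  rw [key A hA, key B hB, ENNReal.mul_iSup, ENNReal.mul_iSup]
  refine ENNReal.iSup_add_iSup_le ?_
  rintro ⟨K, hKA, hK⟩ ⟨L, hLB, hL⟩
  have h1 := volume_add_volume_le_of_compact (hK.insert x₀) (hL.insert y₀)
    ⟨x₀, by simp⟩ ⟨y₀, by simp⟩ ha hb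
    (C := C) (fun x hx y hy => h x (Set.insert_subset hx₀ hKA hx) y (Set.insert_subset hy₀ hLB hy))
  refine le_trans ?_ h1
  gcongr <;> exact Set.subset_insert _ _

theorem lintegral_eq_lintegral_Ioo_meas {f : ℝ → ℝ≥0∞} (hf : Measurable f) (h1 : ∀ x, f x ≤ 1) :
    ∫⁻ x, f x = ∫⁻ t in Set.Ioo (0 : ℝ) 1, volume {x | ENNReal.ofReal t < f x} := by
  have hfin : ∀ x, f x ≠ ∞ := fun x => ((h1 x).trans_lt ENNReal.one_lt_top).ne
  have e1 : ∫⁻ x, f x = ∫⁻ x, ENNReal.ofReal (f x).toReal := by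
    simp [ENNReal.ofReal_toReal, hfin]
  rw [e1, lintegral_eq_lintegral_meas_lt volume (Filter.Eventually.of_forall fun x => by positivity)
    hf.ennreal_toReal.aemeasurable]
  rw [← Set.Ioo_union_Ici_eq_Ioi zero_lt_one, lintegral_union measurableSet_Ici
    (Set.disjoint_left.2 fun x hx hx' => not_lt.2 hx' hx.2)]
  have e3 : ∫⁻ t in Set.Ici (1 : ℝ), volume {x | t < (f x).toReal} = 0 := by
    rw [setLIntegral_congr_fun (g := fun _ => 0) measurableSet_Ici]
    · simp
    · intro t ht
      have : {x | t < (f x).toReal} = ∅ := by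
        ext x
        simp only [Set.mem_ofPred_eq, Set.mem_empty_iff_false, iff_false, not_lt]
        refine le_trans ?_ ht
        simpa using ENNReal.toReal_mono ENNReal.one_ne_top (h1 x)
      simp [this]
  rw [e3, add_zero]
  refine setLIntegral_congr_fun measurableSet_Ioo fun t ht => ?_
  simp only [ENNReal.ofReal_lt_iff_lt_toReal ht.1.le (hfin _)]

theorem add_lintegral_le_of_sup_eq_one {f g h : ℝ → ℝ≥0∞} (hf : Measurable f) (hg : Measurable g)
    (hh : Measurable h) {a b : ℝ} (ha : 0 < a) (hb : 0 < b) (hab : a + b = 1)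
    (hf1 : ⨆ x, f x = 1) (hg1 : ⨆ x, g x = 1)
    (hfgh : ∀ x y, f x ^ a * g y ^ b ≤ h (a * x + b * y)) :
    ENNReal.ofReal a * (∫⁻ x, f x) + ENNReal.ofReal b * (∫⁻ x, g x) ≤ ∫⁻ x, h x := by
  have hmin : ∫⁻ x, min (h x) 1 ≤ ∫⁻ x, h x := lintegral_mono fun x => min_le_left _ _
  refine le_trans ?_ hmin
  rw [lintegral_eq_lintegral_Ioo_meas hf fun x => hf1 ▸ le_iSup f x,
    lintegral_eq_lintegral_Ioo_meas hg fun x => hg1 ▸ le_iSup g x,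
    lintegral_eq_lintegral_Ioo_meas (hh.min measurable_const) fun x => min_le_right _ _]
  rw [← lintegral_const_mul' _ _ ENNReal.ofReal_ne_top,
    ← lintegral_const_mul' _ _ ENNReal.ofReal_ne_top, ← lintegral_add_left']
  · refine setLIntegral_mono' measurableSet_Ioo fun t ht => ?_
    have ht1 : ENNReal.ofReal t < 1 := by
      rw [← ENNReal.ofReal_one]; exact (ENNReal.ofReal_lt_ofReal_iff one_pos).2 ht.2
    obtain ⟨x₀, hx₀⟩ := lt_iSup_iff.1 (hf1.symm ▸ ht1)
    obtain ⟨y₀, hy₀⟩ := lt_iSup_iff.1 (hg1.symm ▸ ht1)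
    refine volume_add_volume_le (A := {x | ENNReal.ofReal t < f x})
      (B := {x | ENNReal.ofReal t < g x}) (hf measurableSet_Ioi) (hg measurableSet_Ioi)
      ⟨x₀, hx₀⟩ ⟨y₀, hy₀⟩ ha hb ?_
    intro x hx y hy
    refine lt_min (lt_of_lt_of_le ?_ (hfgh x y)) ht1
    have h0 : ENNReal.ofReal t ≠ 0 := by simpa using ht.1
    calc ENNReal.ofReal t = ENNReal.ofReal t ^ a * ENNReal.ofReal t ^ b := by
          rw [← ENNReal.rpow_add _ _ h0 ENNReal.ofReal_ne_top, hab, ENNReal.rpow_one]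
      _ < f x ^ a * g y ^ b :=
          ENNReal.mul_lt_mul (ENNReal.rpow_lt_rpow hx ha) (ENNReal.rpow_lt_rpow hy hb)
  · refine AEMeasurable.const_mul (Antitone.measurable ?_).aemeasurable _
    intro s t hst
    exact measure_mono fun x hx => (ENNReal.ofReal_le_ofReal hst).trans_lt hx

theorem ENNReal.rpow_mul_rpow_le_add {a b : ℝ} (ha : 0 < a) (hb : 0 < b) (hab : a + b = 1)
    (x y : ℝ≥0∞) : x ^ a * y ^ b ≤ ENNReal.ofReal a * x + ENNReal.ofReal b * y := by
  rcases eq_or_ne x ∞ with rfl | hx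
  · simp [ENNReal.mul_top, ha]
  rcases eq_or_ne y ∞ with rfl | hy
  · simp [ENNReal.mul_top, hb]
  lift x to NNReal using hx
  lift y to NNReal using hy
  lift a to NNReal using ha.le
  lift b to NNReal using hb.le
  have := NNReal.geom_mean_le_arith_mean2_weighted a b x y (by exact_mod_cast hab)
  rw [← ENNReal.coe_rpow_of_nonneg _ ha.le, ← ENNReal.coe_rpow_of_nonneg _ hb.le]
  simp only [ENNReal.ofReal_coe_nnreal]
  exact_mod_cast this

theorem prekopa_leindler_of_bounded {f g h : ℝ → ℝ≥0∞} (hf : Measurable f) (hg : Measurable g)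
    (hh : Measurable h) {a b : ℝ} (ha : 0 < a) (hb : 0 < b) (hab : a + b = 1)
    (hf1 : ⨆ x, f x ≠ ∞) (hg1 : ⨆ x, g x ≠ ∞)
    (hfgh : ∀ x y, f x ^ a * g y ^ b ≤ h (a * x + b * y)) :
    (∫⁻ x, f x) ^ a * (∫⁻ x, g x) ^ b ≤ ∫⁻ x, h x := by
  set F := ⨆ x, f x with hF
  set G := ⨆ x, g x with hG
  rcases eq_or_ne F 0 with hF0 | hF0
  · have : f = 0 := by
      ext x; simpa using (iSup_eq_bot.1 (hF.symm.trans hF0)) x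
    simp [this, ha]
  rcases eq_or_ne G 0 with hG0 | hG0
  · have : g = 0 := by
      ext x; simpa using (iSup_eq_bot.1 (hG.symm.trans hG0)) x
    simp [this, hb]
  have hFa0 : F ^ a ≠ 0 := by simp [hF0, ha, hf1]
  have hFat : F ^ a ≠ ∞ := ENNReal.rpow_ne_top_of_nonneg ha.le hf1
  have hGb0 : G ^ b ≠ 0 := by simp [hG0, hb, hg1]
  have hGbt : G ^ b ≠ ∞ := ENNReal.rpow_ne_top_of_nonneg hb.le hg1
  have key := add_lintegral_le_of_sup_eq_one (f := fun x => F⁻¹ * f x) (g := fun x => G⁻¹ * g x)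
    (h := fun x => (F ^ a * G ^ b)⁻¹ * h x) (hf.const_mul _) (hg.const_mul _) (hh.const_mul _)
    ha hb hab (by rw [← ENNReal.mul_iSup, ENNReal.inv_mul_cancel hF0 hf1])
    (by rw [← ENNReal.mul_iSup, ENNReal.inv_mul_cancel hG0 hg1]) (by
      intro x y
      rw [ENNReal.mul_rpow_of_nonneg _ _ ha.le, ENNReal.mul_rpow_of_nonneg _ _ hb.le,
        ENNReal.mul_inv (Or.inl hFa0) (Or.inl hFat), ENNReal.inv_rpow, ENNReal.inv_rpow,
        mul_mul_mul_comm]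
      gcongr
      exact hfgh x y)
  rw [lintegral_const_mul _ hf, lintegral_const_mul _ hg, lintegral_const_mul _ hh] at key
  have key2 := (ENNReal.rpow_mul_rpow_le_add ha hb hab _ _).trans key
  rw [ENNReal.mul_rpow_of_nonneg _ _ ha.le, ENNReal.mul_rpow_of_nonneg _ _ hb.le,
    ENNReal.inv_rpow, ENNReal.inv_rpow, mul_mul_mul_comm,
    ← ENNReal.mul_inv (Or.inl hFa0) (Or.inl hFat)] at key2
  exact (ENNReal.mul_le_mul_iff_right (ENNReal.inv_ne_zero.2 (ENNReal.mul_ne_top hFat hGbt))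
    (ENNReal.inv_ne_top.2 (mul_ne_zero hFa0 hGb0))).1 key2

theorem tendsto_lintegral_min_natCast {f : ℝ → ℝ≥0∞} (hf : Measurable f) :
    Filter.Tendsto (fun k : ℕ => ∫⁻ x, min (f x) k) Filter.atTop (nhds (∫⁻ x, f x)) := by
  refine lintegral_tendsto_of_tendsto_of_monotone (fun k => (hf.min measurable_const).aemeasurable)
    (Filter.Eventually.of_forall fun x k l hkl => ?_) (Filter.Eventually.of_forall fun x => ?_)
  · exact min_le_min le_rfl (by exact_mod_cast hkl)
  · have := (tendsto_const_nhds (x := f x)).min ENNReal.tendsto_nat_nhds_top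
    simpa using this

/-- The one-dimensional Prékopa–Leindler inequality. -/
theorem prekopa_leindler_real {f g h : ℝ → ℝ≥0∞} (hf : Measurable f) (hg : Measurable g)
    (hh : Measurable h) {a b : ℝ} (ha : 0 < a) (hb : 0 < b) (hab : a + b = 1)
    (hfgh : ∀ x y, f x ^ a * g y ^ b ≤ h (a * x + b * y)) :
    (∫⁻ x, f x) ^ a * (∫⁻ x, g x) ^ b ≤ ∫⁻ x, h x := by
  rcases eq_or_ne (∫⁻ x, f x) 0 with hf0 | hf0
  · simp [hf0, ha]
  rcases eq_or_ne (∫⁻ x, g x) 0 with hg0 | hg0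
  · simp [hg0, hb]
  have hlim := ENNReal.Tendsto.mul
    ((ENNReal.continuous_rpow_const (y := a)).tendsto _ |>.comp (tendsto_lintegral_min_natCast hf))
    (Or.inl (by simp [hf0, ha, ha.not_gt]))
    ((ENNReal.continuous_rpow_const (y := b)).tendsto _ |>.comp (tendsto_lintegral_min_natCast hg))
    (Or.inl (by simp [hg0, hb, hb.not_gt]))
  refine le_of_tendsto' hlim fun k => ?_
  refine prekopa_leindler_of_bounded (hf.min measurable_const) (hg.min measurable_const) hh ha hb
    hab (ne_top_of_le_ne_top (ENNReal.natCast_ne_top k) (iSup_le fun x => min_le_right _ _))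
    (ne_top_of_le_ne_top (ENNReal.natCast_ne_top k) (iSup_le fun x => min_le_right _ _)) ?_
  intro x y
  refine le_trans ?_ (hfgh x y)
  gcongr <;> exact min_le_left _ _

theorem lintegral_fin_succ {n : ℕ} {f : (Fin (n + 1) → ℝ) → ℝ≥0∞} (hf : Measurable f) :
    ∫⁻ x, f x = ∫⁻ s : ℝ, ∫⁻ x : Fin n → ℝ, f (Fin.cons s x) := by
  have hmp := (volume_preserving_piFinSuccAbove (fun _ : Fin (n + 1) => ℝ) 0).symm
  rw [← hmp.lintegral_comp hf, Measure.volume_eq_prod, lintegral_prod]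
  · simp [MeasurableEquiv.piFinSuccAbove, Fin.insertNthEquiv, Fin.insertNth_zero']
  · exact (hf.comp (MeasurableEquiv.measurable _)).aemeasurable

theorem measurable_finCons {n : ℕ} :
    Measurable fun p : ℝ × (Fin n → ℝ) => (Fin.cons p.1 p.2 : Fin (n + 1) → ℝ) := by
  refine measurable_pi_iff.2 fun i => ?_
  refine Fin.cases ?_ (fun j => ?_) i
  · simpa using measurable_fst
  · simp only [Fin.cons_succ]; fun_prop

/-- The Prékopa–Leindler inequality. -/
theorem prekopa_leindler {n : ℕ} {f g h : (Fin n → ℝ) → ℝ≥0∞} (hf : Measurable f)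
    (hg : Measurable g) (hh : Measurable h) {a b : ℝ} (ha : 0 < a) (hb : 0 < b) (hab : a + b = 1)
    (hfgh : ∀ x y, f x ^ a * g y ^ b ≤ h (a • x + b • y)) :
    (∫⁻ x, f x) ^ a * (∫⁻ x, g x) ^ b ≤ ∫⁻ x, h x := by
  induction n with
  | zero =>
    have e : ∀ F : (Fin 0 → ℝ) → ℝ≥0∞, ∫⁻ x, F x = F 0 := by
      intro F
      rw [volume_pi, Measure.pi_of_empty _ 0]
      simp
    rw [e f, e g, e h]
    simpa using hfgh 0 0
  | succ n ih =>
    have hc := measurable_finCons (n := n)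
    rw [lintegral_fin_succ hf, lintegral_fin_succ hg, lintegral_fin_succ hh]
    refine prekopa_leindler_real (hf.comp hc).lintegral_prod_right'
      (hg.comp hc).lintegral_prod_right' (hh.comp hc).lintegral_prod_right' ha hb hab ?_
    intro s t
    have hs : ∀ s : ℝ, Measurable fun x : Fin n → ℝ => (Fin.cons s x : Fin (n + 1) → ℝ) :=
      fun s => hc.comp measurable_prodMk_left
    refine ih (hf.comp (hs s)) (hg.comp (hs t)) (hh.comp (hs _)) ?_
    intro x y
    have hcons : a • (Fin.cons s x : Fin (n + 1) → ℝ) + b • (Fin.cons t y : Fin (n + 1) → ℝ) =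
        Fin.cons (a * s + b * t) (a • x + b • y) := by
      ext i
      refine Fin.cases ?_ (fun j => ?_) i <;> simp
    have := hfgh (Fin.cons s x) (Fin.cons t y)
    rwa [hcons] at this

end PrekopaLeindler

theorem eq_zero_of_nonpos_of_integral_nonneg {F : ℝ → ℝ} (hc : Continuous F)
    (hi : Integrable F) (h0 : ∀ s, F s ≤ 0) (h : 0 ≤ ∫ s, F s) : F = 0 := by
  have h1 : ∫ s, -F s = 0 := by
    refine le_antisymm ?_ (integral_nonneg fun s => by simpa using h0 s)
    rw [integral_neg]; linarith
  rw [integral_eq_zero_iff_of_nonneg (f := fun s => -F s) (fun s => by simpa using h0 s)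
    hi.neg] at h1
  have h2 := (Continuous.ae_eq_iff_eq volume hc.neg continuous_const).1 h1
  funext s
  exact neg_eq_zero.1 (congrFun h2 s)

theorem integrable_pow_mul_gaussian {δ : ℝ} (hδ : 0 < δ) (k : ℕ) :
    Integrable fun s : ℝ => s ^ k * Real.exp (-(δ * s ^ 2 / 2)) := by
  have := integrable_rpow_mul_exp_neg_mul_sq (b := δ / 2) (by positivity) (s := k)
    (by have : (0 : ℝ) ≤ k := by positivity
        linarith)
  convert this using 3 with s
  · rw [Real.rpow_natCast]
  · ring_nf

theorem integral_quadratic_mul_gaussian {δ : ℝ} (hδ : 0 < δ) (κ : ℝ) :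
    ∫ s : ℝ, (s ^ 2 + κ * s - 1 / δ) * Real.exp (-(δ * s ^ 2 / 2)) = 0 := by
  have h0 := integrable_pow_mul_gaussian hδ 0
  have h1 := integrable_pow_mul_gaussian hδ 1
  have h2 := integrable_pow_mul_gaussian hδ 2
  refine integral_eq_zero_of_hasDerivAt_of_integrable
    (f := fun s => -(s + κ) / δ * Real.exp (-(δ * s ^ 2 / 2))) (fun s => ?_) ?_ ?_
  · have e : HasDerivAt (fun s : ℝ => -(δ * s ^ 2 / 2)) (-(δ * s)) s := by
      refine ((((hasDerivAt_id' s).pow 2).const_mul δ).div_const 2).neg.congr_deriv ?_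
      push_cast
      ring
    refine ((((hasDerivAt_id' s).add_const κ).neg.div_const δ).mul e.exp).congr_deriv ?_
    simp only [Pi.neg_apply]
    field_simp
    ring
  · have := (h2.add (h1.const_mul κ)).sub (h0.const_mul (1 / δ))
    refine this.congr (Filter.Eventually.of_forall fun s => ?_)
    simp only [Pi.add_apply, Pi.sub_apply]
    ring
  · have := (h1.const_mul (-1 / δ)).add (h0.const_mul (-κ / δ))
    refine this.congr (Filter.Eventually.of_forall fun s => ?_)
    simp only [Pi.add_apply]
    ring

theorem integral_add_sub_sub {f g h k : ℝ → ℝ} (hf : Integrable f) (hg : Integrable g)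
    (hh : Integrable h) (hk : Integrable k) {b c d : ℝ} :
    ∫ s, (f s + b * g s - c * h s - d * k s) =
      (∫ s, f s) + b * (∫ s, g s) - c * (∫ s, h s) - d * ∫ s, k s := by
  have i1 : Integrable fun s => f s + b * g s := hf.add (hg.const_mul b)
  have i2 : Integrable fun s => f s + b * g s - c * h s := i1.sub (hh.const_mul c)
  rw [integral_sub i2 (hk.const_mul d), integral_sub i1 (hh.const_mul c),
    integral_add hf (hg.const_mul b), integral_const_mul, integral_const_mul, integral_const_mul]

theorem const_of_monotone_of_mean_zero {ψ : ℝ → ℝ} (hψ : Continuous ψ) (hmono : Monotone ψ)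
    {δ : ℝ} (hδ : 0 < δ)
    (hi : Integrable fun s => s * (Real.exp (-(δ * s ^ 2 / 2)) * Real.exp (-ψ s)))
    (h1 : ∫ s, s * (Real.exp (-(δ * s ^ 2 / 2)) * Real.exp (-ψ s)) = 0) (s : ℝ) :
    ψ s = ψ 0 := by
  have g1 := integrable_pow_mul_gaussian hδ 1
  have g0 : ∫ s : ℝ, s ^ 1 * Real.exp (-(δ * s ^ 2 / 2)) = 0 := by
    have e1 := integral_quadratic_mul_gaussian hδ 1
    have e0 := integral_quadratic_mul_gaussian hδ 0
    have h0 := integrable_pow_mul_gaussian hδ 0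
    have h2 := integrable_pow_mul_gaussian hδ 2
    have i0 : Integrable fun s : ℝ => (s ^ 2 + 0 * s - 1 / δ) * Real.exp (-(δ * s ^ 2 / 2)) :=
      (h2.sub (h0.const_mul (1 / δ))).congr
        (Filter.Eventually.of_forall fun s => by simp only [Pi.sub_apply]; ring)
    have : ∀ s : ℝ, (s ^ 2 + 1 * s - 1 / δ) * Real.exp (-(δ * s ^ 2 / 2)) =
      (s ^ 2 + 0 * s - 1 / δ) * Real.exp (-(δ * s ^ 2 / 2)) +
        s ^ 1 * Real.exp (-(δ * s ^ 2 / 2)) := fun s => by ring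
    simp only [this] at e1
    rwa [integral_add i0 g1, e0, zero_add] at e1
  have hF := eq_zero_of_nonpos_of_integral_nonneg
    (F := fun s => s * (Real.exp (-(δ * s ^ 2 / 2)) * Real.exp (-ψ s)) -
      Real.exp (-ψ 0) * (s ^ 1 * Real.exp (-(δ * s ^ 2 / 2)))) (by fun_prop)
    (hi.sub (g1.const_mul _)) (fun s => by
      have e : s * (Real.exp (-(δ * s ^ 2 / 2)) * Real.exp (-ψ s)) -
          Real.exp (-ψ 0) * (s ^ 1 * Real.exp (-(δ * s ^ 2 / 2))) =
          Real.exp (-(δ * s ^ 2 / 2)) * (s * (Real.exp (-ψ s) - Real.exp (-ψ 0))) := by ring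
      rw [e]
      refine mul_nonpos_of_nonneg_of_nonpos (by positivity) ?_
      rcases le_total 0 s with hs | hs
      · refine mul_nonpos_of_nonneg_of_nonpos hs (sub_nonpos.2 (Real.exp_le_exp.2 ?_))
        linarith [hmono hs]
      · refine mul_nonpos_of_nonpos_of_nonneg hs (sub_nonneg.2 (Real.exp_le_exp.2 ?_))
        linarith [hmono hs])
    (by rw [integral_sub hi (g1.const_mul _), h1, integral_const_mul, g0]; simp)
  rcases eq_or_ne s 0 with rfl | hs
  · rfl
  have e := congrFun hF s
  have e' : Real.exp (-(δ * s ^ 2 / 2)) * s * (Real.exp (-ψ s) - Real.exp (-ψ 0)) = 0 := by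
    simp only [Pi.zero_apply] at e
    linarith
  have := (mul_eq_zero.1 e').resolve_left (mul_ne_zero (Real.exp_pos _).ne' hs)
  have := Real.exp_injective (sub_eq_zero.1 this)
  linarith

theorem const_of_antitone_of_mean_zero {ψ : ℝ → ℝ} (hψ : Continuous ψ) (hanti : Antitone ψ)
    {δ : ℝ} (hδ : 0 < δ)
    (hi : Integrable fun s => s * (Real.exp (-(δ * s ^ 2 / 2)) * Real.exp (-ψ s)))
    (h1 : ∫ s, s * (Real.exp (-(δ * s ^ 2 / 2)) * Real.exp (-ψ s)) = 0) (s : ℝ) :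
    ψ s = ψ 0 := by
  have e : ∀ s : ℝ, s * (Real.exp (-(δ * s ^ 2 / 2)) * Real.exp (-ψ (-s))) =
      - (fun s => s * (Real.exp (-(δ * s ^ 2 / 2)) * Real.exp (-ψ s))) (-s) := by
    intro s; simp
  have := const_of_monotone_of_mean_zero (ψ := fun s => ψ (-s)) (by fun_prop)
    (fun s t hst => hanti (neg_le_neg hst)) hδ (by simp only [e]; exact hi.comp_neg.neg)
    (by simp only [e]; rw [integral_neg,
      integral_neg_eq_self (fun s => s * (Real.exp (-(δ * s ^ 2 / 2)) * Real.exp (-ψ s))), h1,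
      neg_zero]) (-s)
  simpa using this

/-- A convex function that is not nondecreasing grows at least linearly at `-∞`. -/
theorem exists_lt_of_not_monotone {ψ : ℝ → ℝ} (hψ : ConvexOn ℝ Set.univ ψ) (h : ¬ Monotone ψ)
    (K : ℝ) : ∃ x₀ < 0, ∀ x ≤ x₀, K < ψ x := by
  simp only [Monotone, not_forall, not_le] at h
  obtain ⟨a, b, hab, hlt⟩ := h
  have hab : a < b := lt_of_le_of_ne hab (by rintro rfl; exact lt_irrefl _ hlt)
  set c := (ψ a - ψ b) / (b - a) with hc
  have hcpos : 0 < c := div_pos (by linarith) (by linarith)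
  refine ⟨min (min (a - 1) (-1)) (a - (|K - ψ a| + 1) / c), ?_, fun x hx => ?_⟩
  · exact (min_le_left _ _).trans_lt ((min_le_right _ _).trans_lt (by norm_num))
  · have hx1 : x ≤ a - 1 := hx.trans ((min_le_left _ _).trans (min_le_left _ _))
    have hx2 : x ≤ a - (|K - ψ a| + 1) / c := hx.trans (min_le_right _ _)
    have hs := hψ.slope_mono_adjacent (Set.mem_univ x) (Set.mem_univ b) (by linarith : x < a) hab
    have hs' : (ψ a - ψ x) / (a - x) ≤ -c := by
      refine hs.trans_eq ?_
      rw [hc, ← neg_div]; congr 1; ring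
    rw [div_le_iff₀ (by linarith)] at hs'
    have h3 : |K - ψ a| + 1 ≤ (a - x) * c := by
      rw [← div_le_iff₀ hcpos]; linarith
    have := le_abs_self (K - ψ a)
    nlinarith

theorem exists_eq_at_reciprocal {ψ : ℝ → ℝ} (hψ : ConvexOn ℝ Set.univ ψ) (hc : Continuous ψ)
    (h : ¬ Monotone ψ) (h' : ¬ Antitone ψ) {r : ℝ} (hr : 0 < r) :
    ∃ s > 0, ψ s = ψ (-(r / s)) := by
  have bound : ∀ φ : ℝ → ℝ, Continuous φ → ConvexOn ℝ Set.univ φ → ¬ Monotone φ →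
      ∃ s > 0, φ s ≤ φ (-(r / s)) := by
    intro φ hφc hφ hm
    obtain ⟨x₀, hx₀, hx⟩ := exists_lt_of_not_monotone hφ hm (max (φ 0) (φ 1))
    have hpos : 0 < r / (-x₀) := div_pos hr (by linarith)
    refine ⟨min 1 (r / (-x₀)), lt_min one_pos hpos, ?_⟩
    set s := min 1 (r / (-x₀)) with hs
    have hs0 : 0 < s := lt_min one_pos hpos
    have h1 : φ s ≤ max (φ 0) (φ 1) :=
      hφ.le_max_of_mem_Icc (Set.mem_univ _) (Set.mem_univ _) ⟨hs0.le, min_le_left _ _⟩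
    have h2 : -(r / s) ≤ x₀ := by
      have : s ≤ r / (-x₀) := min_le_right _ _
      rw [le_div_iff₀ (by linarith)] at this
      have h3 : -x₀ ≤ r / s := by rw [le_div_iff₀ hs0]; linarith
      linarith
    exact h1.trans (hx _ h2).le
  obtain ⟨s, hs, hs'⟩ := bound ψ hc hψ h
  obtain ⟨t, ht, ht'⟩ := bound (fun x => ψ (-x)) (by fun_prop)
    (by simpa [Function.comp_def] using hψ.comp_linearMap (-LinearMap.id))
    (fun hm => h' fun x y hxy => by simpa using hm (neg_le_neg hxy))
  have hco : ContinuousOn (fun s => ψ s - ψ (-(r / s))) (Set.Ioi 0) := by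
    refine hc.continuousOn.sub (hc.comp_continuousOn ?_)
    exact (continuousOn_const.div continuousOn_id fun x hx => ne_of_gt hx).neg
  have hrt : 0 < r / t := div_pos hr ht
  have h3 : r / (r / t) = t := by field_simp
  have := isPreconnected_Ioi.intermediate_value (s := Set.Ioi (0 : ℝ)) hs hrt hco
  have h0 : (0 : ℝ) ∈ Set.Icc (ψ s - ψ (-(r / s))) (ψ (r / t) - ψ (-(r / (r / t)))) := by
    rw [h3]
    simp only [neg_neg] at ht'
    exact ⟨by linarith, by linarith⟩
  obtain ⟨x, hx, hxf⟩ := this h0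
  exact ⟨x, hx, by simpa [sub_eq_zero] using hxf⟩

/-- A centred one-dimensional density that is log-concave relative to a Gaussian of variance
`1 / δ`, and not itself Gaussian, has variance less than `1 / δ`. -/
theorem second_moment_lt_of_mean_zero {ψ : ℝ → ℝ} (hψ : ConvexOn ℝ Set.univ ψ)
    (hc : Continuous ψ) (hnc : ∃ s, ψ s ≠ ψ 0) {δ : ℝ} (hδ : 0 < δ)
    (i0 : Integrable fun s => Real.exp (-(δ * s ^ 2 / 2)) * Real.exp (-ψ s))
    (i1 : Integrable fun s => s * (Real.exp (-(δ * s ^ 2 / 2)) * Real.exp (-ψ s)))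
    (i2 : Integrable fun s => s ^ 2 * (Real.exp (-(δ * s ^ 2 / 2)) * Real.exp (-ψ s)))
    (h1 : ∫ s, s * (Real.exp (-(δ * s ^ 2 / 2)) * Real.exp (-ψ s)) = 0) :
    δ * ∫ s, s ^ 2 * (Real.exp (-(δ * s ^ 2 / 2)) * Real.exp (-ψ s)) <
      ∫ s, Real.exp (-(δ * s ^ 2 / 2)) * Real.exp (-ψ s) := by
  obtain ⟨s₀, hs₀⟩ := hnc
  obtain ⟨t, ht, hψt⟩ := exists_eq_at_reciprocal hψ hc
    (fun hm => hs₀ (const_of_monotone_of_mean_zero hc hm hδ i1 h1 s₀))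
    (fun hm => hs₀ (const_of_antitone_of_mean_zero hc hm hδ i1 h1 s₀)) (one_div_pos.2 hδ)
  obtain ⟨t', ht'⟩ : ∃ t', t' = -(1 / δ / t) := ⟨_, rfl⟩
  rw [← ht'] at hψt
  have ht'0 : t' < 0 := by rw [ht', neg_lt_zero]; positivity
  set κ := -(t + t') with hκ
  have hprod : t * t' = -(1 / δ) := by rw [ht']; field_simp
  have hq : ∀ s : ℝ, s ^ 2 + κ * s - 1 / δ = (s - t) * (s - t') := fun s => by
    rw [hκ]; linear_combination -hprod
  by_contra! hcon
  have g0 := integrable_pow_mul_gaussian hδ 0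
  have g1 := integrable_pow_mul_gaussian hδ 1
  have g2 := integrable_pow_mul_gaussian hδ 2
  have gi : Integrable fun s : ℝ => (s ^ 2 + κ * s - 1 / δ) * Real.exp (-(δ * s ^ 2 / 2)) :=
    ((g2.add (g1.const_mul κ)).sub (g0.const_mul (1 / δ))).congr
      (Filter.Eventually.of_forall fun s => by
        simp only [Pi.add_apply, Pi.sub_apply]; ring)
  have hF := eq_zero_of_nonpos_of_integral_nonneg
    (F := fun s => s ^ 2 * (Real.exp (-(δ * s ^ 2 / 2)) * Real.exp (-ψ s)) +
      κ * (s * (Real.exp (-(δ * s ^ 2 / 2)) * Real.exp (-ψ s))) -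
      1 / δ * (Real.exp (-(δ * s ^ 2 / 2)) * Real.exp (-ψ s)) -
      Real.exp (-ψ t) * ((s ^ 2 + κ * s - 1 / δ) * Real.exp (-(δ * s ^ 2 / 2))))
    (by fun_prop) (((i2.add (i1.const_mul κ)).sub (i0.const_mul (1 / δ))).sub (gi.const_mul _))
    (fun s => by
      have e : s ^ 2 * (Real.exp (-(δ * s ^ 2 / 2)) * Real.exp (-ψ s)) +
          κ * (s * (Real.exp (-(δ * s ^ 2 / 2)) * Real.exp (-ψ s))) -
          1 / δ * (Real.exp (-(δ * s ^ 2 / 2)) * Real.exp (-ψ s)) -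
          Real.exp (-ψ t) * ((s ^ 2 + κ * s - 1 / δ) * Real.exp (-(δ * s ^ 2 / 2))) =
          Real.exp (-(δ * s ^ 2 / 2)) *
            ((s - t) * (s - t') * (Real.exp (-ψ s) - Real.exp (-ψ t))) := by
        linear_combination Real.exp (-(δ * s ^ 2 / 2)) *
          (Real.exp (-ψ s) - Real.exp (-ψ t)) * hq s
      rw [e]
      refine mul_nonpos_of_nonneg_of_nonpos (by positivity) ?_
      have hexp : ∀ {x y}, x ≤ y → Real.exp (-y) ≤ Real.exp (-x) := fun h =>
        Real.exp_le_exp.2 (neg_le_neg h)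
      rcases lt_trichotomy s t' with h | rfl | h
      · have := hψ.slope_mono_adjacent (Set.mem_univ s) (Set.mem_univ t) h (ht'0.trans ht)
        rw [hψt, sub_self, zero_div, div_le_iff₀ (by linarith), zero_mul] at this
        have := hexp (show ψ t ≤ ψ s by linarith)
        exact mul_nonpos_of_nonneg_of_nonpos
          (mul_nonneg_of_nonpos_of_nonpos (by linarith) (by linarith)) (by linarith)
      · simp
      rcases lt_trichotomy s t with h' | rfl | h'
      · have := hψ.le_max_of_mem_Icc (Set.mem_univ t') (Set.mem_univ t) ⟨h.le, h'.le⟩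
        rw [← hψt, max_self] at this
        have := hexp this
        exact mul_nonpos_of_nonpos_of_nonneg
          (mul_nonpos_of_nonpos_of_nonneg (by linarith) (by linarith)) (by linarith)
      · simp
      · have := hψ.slope_mono_adjacent (Set.mem_univ t') (Set.mem_univ s) (ht'0.trans ht) h'
        rw [hψt, sub_self, zero_div, le_div_iff₀ (by linarith), zero_mul] at this
        have := hexp (show ψ t ≤ ψ s by linarith)
        exact mul_nonpos_of_nonneg_of_nonpos
          (mul_nonneg (by linarith) (by linarith)) (by linarith))
    (by
      rw [integral_add_sub_sub i2 i1 i0 gi, h1, integral_quadratic_mul_gaussian hδ κ]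
      have : 1 / δ * ∫ s, Real.exp (-(δ * s ^ 2 / 2)) * Real.exp (-ψ s) ≤
        ∫ s, s ^ 2 * (Real.exp (-(δ * s ^ 2 / 2)) * Real.exp (-ψ s)) := by
        rw [one_div, inv_mul_le_iff₀ hδ]; exact hcon
      linarith)
  have hall : ∀ s, s ≠ t → s ≠ t' → ψ s = ψ t := by
    intro s hst hst'
    have e := congrFun hF s
    have e' : Real.exp (-(δ * s ^ 2 / 2)) * ((s - t) * (s - t')) *
        (Real.exp (-ψ s) - Real.exp (-ψ t)) = 0 := by
      simp only [Pi.zero_apply] at e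
      linear_combination e - Real.exp (-(δ * s ^ 2 / 2)) *
        (Real.exp (-ψ s) - Real.exp (-ψ t)) * hq s
    have := (mul_eq_zero.1 e').resolve_left (mul_ne_zero (Real.exp_pos _).ne'
      (mul_ne_zero (sub_ne_zero.2 hst) (sub_ne_zero.2 hst')))
    have := Real.exp_injective (sub_eq_zero.1 this)
    linarith
  have hall' : ∀ s, ψ s = ψ t := by
    intro s
    by_cases h : s = t
    · rw [h]
    by_cases h' : s = t'
    · rw [h', hψt]
    exact hall s h h'
  exact hs₀ ((hall' s₀).trans (hall' 0).symm)

theorem pow_mul_exp_neg_sq_le {ε : ℝ} (hε : 0 < ε) (k : ℕ) {r : ℝ} (hr : 0 ≤ r) :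
    r ^ k * Real.exp (-(ε * r ^ 2 / 2)) ≤ k.factorial * Real.exp (1 / (2 * ε)) := by
  have h1 : r ^ k ≤ k.factorial * Real.exp r := by
    have := Real.pow_div_factorial_le_exp r hr k
    rwa [div_le_iff₀' (by positivity)] at this
  calc r ^ k * Real.exp (-(ε * r ^ 2 / 2))
      ≤ k.factorial * Real.exp r * Real.exp (-(ε * r ^ 2 / 2)) := by gcongr
    _ = k.factorial * Real.exp (r - ε * r ^ 2 / 2) := by
        rw [mul_assoc, ← Real.exp_add]; ring_nf
    _ ≤ k.factorial * Real.exp (1 / (2 * ε)) := by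
        gcongr
        have : 1 / (2 * ε) - (r - ε * r ^ 2 / 2) = (ε * r - 1) ^ 2 / (2 * ε) := by
          field_simp; ring
        have : 0 ≤ (ε * r - 1) ^ 2 / (2 * ε) := by positivity
        linarith

theorem integrable_pow_mul_gaussian_mul {f : ℝ → ℝ} (hf : Integrable f) {δ : ℝ} (hδ : 0 < δ)
    (k : ℕ) : Integrable fun s => s ^ k * (Real.exp (-(δ * s ^ 2 / 2)) * f s) := by
  have : ∀ s : ℝ, s ^ k * (Real.exp (-(δ * s ^ 2 / 2)) * f s) =
      (s ^ k * Real.exp (-(δ * s ^ 2 / 2))) * f s := fun s => by ring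
  simp only [this]
  refine hf.bdd_mul (c := k.factorial * Real.exp (1 / (2 * δ)))
    (Continuous.aestronglyMeasurable (by fun_prop)) (Filter.Eventually.of_forall fun s => ?_)
  rw [norm_mul, norm_pow, Real.norm_eq_abs, Real.norm_of_nonneg (Real.exp_pos _).le, ← sq_abs s]
  exact pow_mul_exp_neg_sq_le hδ k (abs_nonneg s)

theorem not_affine_of_integrable_exp_neg {φ : ℝ → ℝ} (hi : Integrable fun s => Real.exp (-φ s))
    {b c : ℝ} (h : ∀ s, φ s = b * s + c) : False := by
  have h2 := hi.add hi.comp_neg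
  have h3 : Integrable fun _ : ℝ => 2 * Real.exp (-c) := by
    refine h2.mono' aestronglyMeasurable_const (Filter.Eventually.of_forall fun s => ?_)
    simp only [Pi.add_apply, h]
    rw [Real.norm_of_nonneg (by positivity)]
    have e1 : Real.exp (-(b * s + c)) = Real.exp (-c) * Real.exp (-(b * s)) := by
      rw [← Real.exp_add]; ring_nf
    have e2 : Real.exp (-(b * -s + c)) = Real.exp (-c) * Real.exp (b * s) := by
      rw [← Real.exp_add]; ring_nf
    rw [e1, e2]
    have := Real.add_one_le_exp (-(b * s))
    have := Real.add_one_le_exp (b * s)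
    nlinarith [Real.exp_pos (-c)]
  rw [integrable_const_iff] at h3
  simp [isFiniteMeasure_iff] at h3

theorem variance_lt_real {φ : ℝ → ℝ} (hφ : ConvexOn ℝ Set.univ φ)
    (hi : Integrable fun s => Real.exp (-φ s)) {δ : ℝ} (hδ : 0 < δ) :
    δ * ((∫ s, s ^ 2 * (Real.exp (-(δ * s ^ 2 / 2)) * Real.exp (-φ s))) *
        (∫ s, Real.exp (-(δ * s ^ 2 / 2)) * Real.exp (-φ s)) -
      (∫ s, s * (Real.exp (-(δ * s ^ 2 / 2)) * Real.exp (-φ s))) ^ 2) <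
      (∫ s, Real.exp (-(δ * s ^ 2 / 2)) * Real.exp (-φ s)) ^ 2 := by
  have hc : Continuous φ := hφ.locallyLipschitz.continuous
  set w : ℝ → ℝ := fun s => Real.exp (-(δ * s ^ 2 / 2)) * Real.exp (-φ s) with hw
  have i0 : Integrable w := by
    simpa using integrable_pow_mul_gaussian_mul hi hδ 0
  have i1 : Integrable fun s => s * w s := by
    simpa using integrable_pow_mul_gaussian_mul hi hδ 1
  have i2 : Integrable fun s => s ^ 2 * w s := integrable_pow_mul_gaussian_mul hi hδ 2
  have hJ0 : 0 < ∫ s, w s := by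
    rw [integral_pos_iff_support_of_nonneg (fun s => by positivity) i0]
    have : Function.support w = Set.univ := by
      ext s; simp [hw, (Real.exp_pos _).ne']
    simp [this]
  change δ * ((∫ s, s ^ 2 * w s) * (∫ s, w s) - (∫ s, s * w s) ^ 2) < (∫ s, w s) ^ 2
  set J0 := ∫ s, w s
  set J1 := ∫ s, s * w s with hJ1
  set J2 := ∫ s, s ^ 2 * w s with hJ2
  set μ := J1 / J0 with hμ
  set ψ : ℝ → ℝ := fun s => φ (s + μ) + (δ * μ * s + δ * μ ^ 2 / 2) with hψ
  have hψw : ∀ s, Real.exp (-(δ * s ^ 2 / 2)) * Real.exp (-ψ s) = w (s + μ) := by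
    intro s
    simp only [hψ, hw]
    rw [← Real.exp_add, ← Real.exp_add]
    ring_nf
  have c1 : ConvexOn ℝ Set.univ ψ := by
    refine ConvexOn.add ?_ ⟨convex_univ, fun x _ y _ a b _ _ hab => ?_⟩
    · simpa [Function.comp_def] using hφ.translate_left μ
    · simp only [smul_eq_mul]
      refine le_of_eq ?_
      linear_combination -(δ * μ ^ 2 / 2) * hab
  have shift : ∀ g : ℝ → ℝ, (∫ s, g s * w (s + μ)) = ∫ s, g (s - μ) * w s := by
    intro g
    simpa using integral_add_right_eq_self (fun s => g (s - μ) * w s) μ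
  have ishift : ∀ g : ℝ → ℝ, (Integrable fun s => g (s - μ) * w s) →
      Integrable fun s => g s * w (s + μ) := by
    intro g hg
    simpa using hg.comp_add_right μ
  have e1 : ∀ s, (s - μ) * w s = s * w s - μ * w s := fun s => by ring
  have e2 : ∀ s, (s - μ) ^ 2 * w s = s ^ 2 * w s - (2 * μ * (s * w s) - μ ^ 2 * w s) :=
    fun s => by ring
  have i1' : Integrable fun s => (s - μ) * w s := by
    simp only [e1]; exact i1.sub (i0.const_mul μ)
  have i12 : Integrable fun s => 2 * μ * (s * w s) - μ ^ 2 * w s :=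
    (i1.const_mul _).sub (i0.const_mul _)
  have i2' : Integrable fun s => (s - μ) ^ 2 * w s := by
    simp only [e2]; exact i2.sub i12
  have key := second_moment_lt_of_mean_zero c1 (by fun_prop) (by
      by_contra! hcon
      refine not_affine_of_integrable_exp_neg hi (b := -(δ * μ))
        (c := ψ 0 + δ * μ ^ 2 / 2) fun s => ?_
      have := hcon (s - μ)
      simp only [hψ, sub_add_cancel] at this ⊢
      linear_combination this) hδ
    (by simp only [hψw]; exact i0.comp_add_right μ)
    (by simp only [hψw]; exact ishift (fun s => s) i1')
    (by simp only [hψw]; exact ishift (fun s => s ^ 2) i2')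
    (by
      simp only [hψw]
      rw [shift (fun s => s)]
      simp only [e1]
      rw [integral_sub i1 (i0.const_mul μ), integral_const_mul, hμ]
      change J1 - J1 / J0 * J0 = 0
      field_simp
      ring)
  simp only [hψw] at key
  rw [shift (fun s => s ^ 2), integral_add_right_eq_self w μ] at key
  simp only [e2] at key
  rw [integral_sub i2 i12, integral_sub (i1.const_mul _) (i0.const_mul _), integral_const_mul,
    integral_const_mul] at key
  change δ * (J2 - (2 * μ * J1 - μ ^ 2 * J0)) < J0 at key
  have h3 : μ * J0 = J1 := by rw [hμ]; field_simp
  calc δ * (J2 * J0 - J1 ^ 2) = δ * (J2 - (2 * μ * J1 - μ ^ 2 * J0)) * J0 := by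
        rw [← h3]; ring
    _ < J0 * J0 := by gcongr
    _ = J0 ^ 2 := by ring
theorem integral_fin_succ {n : ℕ} {f : (Fin (n + 1) → ℝ) → ℝ} (hf : Integrable f) :
    ∫ x, f x = ∫ s : ℝ, ∫ x : Fin n → ℝ, f (Fin.cons s x) := by
  have hmp := (volume_preserving_piFinSuccAbove (fun _ : Fin (n + 1) => ℝ) 0).symm
  rw [← hmp.integral_comp (MeasurableEquiv.measurableEmbedding _), Measure.volume_eq_prod,
    integral_prod]
  · simp [MeasurableEquiv.piFinSuccAbove, Fin.insertNthEquiv, Fin.insertNth_zero']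
  · rw [← Measure.volume_eq_prod]
    exact hmp.integrable_comp_of_integrable hf

theorem continuous_finCons {n : ℕ} :
    Continuous fun p : ℝ × (Fin n → ℝ) => (Fin.cons p.1 p.2 : Fin (n + 1) → ℝ) := by
  refine continuous_pi fun i => ?_
  refine Fin.cases ?_ (fun j => ?_) i
  · simpa using continuous_fst
  · simp only [Fin.cons_succ]; fun_prop

theorem finCons_convexComb {n : ℕ} (a b s t : ℝ) (x y : Fin n → ℝ) :
    (Fin.cons (a * s + b * t) (a • x + b • y) : Fin (n + 1) → ℝ) =
      a • (Fin.cons s x : Fin (n + 1) → ℝ) + b • (Fin.cons t y : Fin (n + 1) → ℝ) := by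
  ext i
  refine Fin.cases ?_ (fun j => ?_) i <;> simp

/-- The marginal on the first coordinate of the density `exp (-W)` weighted by a Gaussian in the
remaining coordinates. -/
noncomputable def gaussianMarginal {n : ℕ} (W : (Fin (n + 1) → ℝ) → ℝ) (δ s : ℝ) : ENNReal :=
  ∫⁻ x : Fin n → ℝ, ENNReal.ofReal
    (Real.exp (-(δ * (∑ i, x i ^ 2) / 2 + W (Fin.cons s x))))

section Marginal

variable {n : ℕ} {W : (Fin (n + 1) → ℝ) → ℝ} {δ : ℝ}

theorem continuous_marginal_exponent (hc : Continuous W) (δ : ℝ) :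
    Continuous fun p : ℝ × (Fin n → ℝ) =>
      Real.exp (-(δ * (∑ i, p.2 i ^ 2) / 2 + W (Fin.cons p.1 p.2))) := by
  have := hc.comp (continuous_finCons (n := n))
  simp only [Function.comp_def] at this
  fun_prop

theorem continuous_marginal_exponent_right (hc : Continuous W) (δ s : ℝ) :
    Continuous fun x : Fin n → ℝ =>
      Real.exp (-(δ * (∑ i, x i ^ 2) / 2 + W (Fin.cons s x))) := by
  have := hc.comp ((continuous_finCons (n := n)).comp (Continuous.prodMk_right s))
  simp only [Function.comp_def] at this
  fun_prop

theorem measurable_gaussianMarginal (hc : Continuous W) : Measurable (gaussianMarginal W δ) :=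
  (continuous_marginal_exponent hc δ).measurable.ennreal_ofReal.lintegral_prod_right'

theorem gaussianMarginal_ne_zero (hc : Continuous W) (s : ℝ) : gaussianMarginal W δ s ≠ 0 := by
  rw [gaussianMarginal, ← pos_iff_ne_zero, lintegral_pos_iff_support
    (continuous_marginal_exponent_right hc δ s).measurable.ennreal_ofReal]
  have : (Function.support fun x : Fin n → ℝ => ENNReal.ofReal
      (Real.exp (-(δ * (∑ i, x i ^ 2) / 2 + W (Fin.cons s x))))) = Set.univ := by
    ext x; simp [Real.exp_pos]
  rw [this]
  exact isOpen_univ.measure_pos volume Set.univ_nonempty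

theorem gaussianMarginal_logConcave (hW : ConvexOn ℝ Set.univ W) (hc : Continuous W) (hδ : 0 < δ)
    {a b : ℝ} (ha : 0 < a) (hb : 0 < b) (hab : a + b = 1) (s t : ℝ) :
    gaussianMarginal W δ s ^ a * gaussianMarginal W δ t ^ b ≤
      gaussianMarginal W δ (a * s + b * t) := by
  refine prekopa_leindler (continuous_marginal_exponent_right hc δ s).measurable.ennreal_ofReal
    (continuous_marginal_exponent_right hc δ t).measurable.ennreal_ofReal
    (continuous_marginal_exponent_right hc δ _).measurable.ennreal_ofReal ha hb hab ?_
  intro x y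
  rw [ENNReal.ofReal_rpow_of_pos (Real.exp_pos _), ENNReal.ofReal_rpow_of_pos (Real.exp_pos _),
    ← ENNReal.ofReal_mul (by positivity), ← Real.exp_mul, ← Real.exp_mul, ← Real.exp_add]
  refine ENNReal.ofReal_le_ofReal (Real.exp_le_exp.2 ?_)
  have h1 := hW.2 (Set.mem_univ (Fin.cons s x)) (Set.mem_univ (Fin.cons t y)) ha.le hb.le hab
  rw [← finCons_convexComb, smul_eq_mul, smul_eq_mul] at h1
  have h2 : ∑ i, (a • x + b • y) i ^ 2 ≤ a * ∑ i, x i ^ 2 + b * ∑ i, y i ^ 2 := by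
    rw [Finset.mul_sum, Finset.mul_sum, ← Finset.sum_add_distrib]
    refine Finset.sum_le_sum fun i _ => ?_
    have hb' : b = 1 - a := by linarith
    have : 0 ≤ a * b * (x i - y i) ^ 2 := by positivity
    simp only [Pi.add_apply, Pi.smul_apply, smul_eq_mul]
    subst hb'
    nlinarith
  have h3 := mul_le_mul_of_nonneg_left h2 hδ.le
  linarith

theorem lintegral_gaussianMarginal_lt_top (hc : Continuous W)
    (hi : Integrable fun z => Real.exp (-W z)) (hδ : 0 < δ) :
    ∫⁻ s, gaussianMarginal W δ s < ⊤ := by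
  calc ∫⁻ s, gaussianMarginal W δ s
      ≤ ∫⁻ s : ℝ, ∫⁻ x : Fin n → ℝ, ENNReal.ofReal (Real.exp (-W (Fin.cons s x))) := by
        refine lintegral_mono fun s => lintegral_mono fun x => ?_
        refine ENNReal.ofReal_le_ofReal (Real.exp_le_exp.2 ?_)
        have : 0 ≤ δ * (∑ i, x i ^ 2) / 2 := by positivity
        linarith
    _ = ∫⁻ z, ENNReal.ofReal (Real.exp (-W z)) :=
        (lintegral_fin_succ (f := fun z => ENNReal.ofReal (Real.exp (-W z)))
          (by fun_prop)).symm
    _ < ⊤ := hi.lintegral_lt_top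

theorem gaussianMarginal_ne_top (hW : ConvexOn ℝ Set.univ W) (hc : Continuous W)
    (hi : Integrable fun z => Real.exp (-W z)) (hδ : 0 < δ) (s : ℝ) :
    gaussianMarginal W δ s ≠ ⊤ := by
  intro hs
  have htop : ∀ t, gaussianMarginal W δ t = ⊤ := by
    intro t
    have := gaussianMarginal_logConcave hW hc hδ (a := 1 / 2) (b := 1 / 2) (by norm_num)
      (by norm_num) (by norm_num) s (2 * t - s)
    rw [hs, ENNReal.top_rpow_of_pos (by norm_num), ENNReal.top_mul] at this
    · rw [top_le_iff] at this
      rwa [show 1 / 2 * s + 1 / 2 * (2 * t - s) = t by ring] at this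
    · have := gaussianMarginal_ne_zero (δ := δ) hc (2 * t - s)
      simp only [ne_eq, ENNReal.rpow_eq_zero_iff, not_or, not_and]
      exact ⟨fun h => absurd h this, fun _ => by norm_num⟩
  have := lintegral_gaussianMarginal_lt_top hc hi hδ
  simp [htop] at this

theorem convexOn_neg_log_gaussianMarginal (hW : ConvexOn ℝ Set.univ W) (hc : Continuous W)
    (hi : Integrable fun z => Real.exp (-W z)) (hδ : 0 < δ) :
    ConvexOn ℝ Set.univ fun s => -Real.log (gaussianMarginal W δ s).toReal := by
  have hpos : ∀ s, 0 < (gaussianMarginal W δ s).toReal := fun s =>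
    ENNReal.toReal_pos (gaussianMarginal_ne_zero hc s) (gaussianMarginal_ne_top hW hc hi hδ s)
  refine convexOn_iff_forall_pos.2 ⟨convex_univ, fun s _ t _ a b ha hb hab => ?_⟩
  have h := ENNReal.toReal_mono (gaussianMarginal_ne_top hW hc hi hδ _)
    (gaussianMarginal_logConcave hW hc hδ ha hb hab s t)
  rw [ENNReal.toReal_mul, ← ENNReal.toReal_rpow, ← ENNReal.toReal_rpow] at h
  have h2 := Real.log_le_log (mul_pos (Real.rpow_pos_of_pos (hpos s) a)
    (Real.rpow_pos_of_pos (hpos t) b)) h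
  rw [Real.log_mul (Real.rpow_pos_of_pos (hpos s) a).ne' (Real.rpow_pos_of_pos (hpos t) b).ne',
    Real.log_rpow (hpos s), Real.log_rpow (hpos t)] at h2
  simp only [smul_eq_mul]
  linarith

theorem integral_pow_mul_eq_marginal (hc : Continuous W)
    (hi : Integrable fun z => Real.exp (-W z)) (hδ : 0 < δ) (k : ℕ) :
    ∫ z : Fin (n + 1) → ℝ, z 0 ^ k * (Real.exp (-(δ * (∑ i, z i ^ 2) / 2)) * Real.exp (-W z)) =
      ∫ s, s ^ k * (Real.exp (-(δ * s ^ 2 / 2)) * (gaussianMarginal W δ s).toReal) := by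
  rw [integral_fin_succ]
  · refine integral_congr_ae (Filter.Eventually.of_forall fun s => ?_)
    have e : ∀ x : Fin n → ℝ, (Fin.cons s x : Fin (n + 1) → ℝ) 0 ^ k *
        (Real.exp (-(δ * (∑ i, (Fin.cons s x : Fin (n + 1) → ℝ) i ^ 2) / 2)) *
          Real.exp (-W (Fin.cons s x))) =
        s ^ k * Real.exp (-(δ * s ^ 2 / 2)) *
          Real.exp (-(δ * (∑ i, x i ^ 2) / 2 + W (Fin.cons s x))) := by
      intro x
      rw [Fin.sum_univ_succ, mul_assoc, ← Real.exp_add, ← Real.exp_add]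
      simp only [Fin.cons_zero, Fin.cons_succ]
      ring_nf
    simp only [e]
    rw [integral_const_mul, gaussianMarginal, mul_assoc, integral_eq_lintegral_of_nonneg_ae
      (Filter.Eventually.of_forall fun x => (Real.exp_pos _).le)
      (continuous_marginal_exponent_right hc δ s).aestronglyMeasurable]
  · have : ∀ z : Fin (n + 1) → ℝ,
        z 0 ^ k * (Real.exp (-(δ * (∑ i, z i ^ 2) / 2)) * Real.exp (-W z)) =
        (z 0 ^ k * Real.exp (-(δ * (∑ i, z i ^ 2) / 2))) * Real.exp (-W z) := fun z => by ring
    simp only [this]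
    refine hi.bdd_mul (c := k.factorial * Real.exp (1 / (2 * δ)))
      (Continuous.aestronglyMeasurable (by fun_prop)) (Filter.Eventually.of_forall fun z => ?_)
    rw [norm_mul, norm_pow, Real.norm_eq_abs, Real.norm_of_nonneg (Real.exp_pos _).le]
    refine le_trans ?_ (pow_mul_exp_neg_sq_le hδ k (abs_nonneg (z 0)))
    gcongr
    rw [sq_abs]
    exact Finset.single_le_sum (f := fun i => z i ^ 2) (fun i _ => sq_nonneg _)
      (Finset.mem_univ 0)

theorem variance_coord_lt (hW : ConvexOn ℝ Set.univ W) (hc : Continuous W)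
    (hi : Integrable fun z => Real.exp (-W z)) (hδ : 0 < δ) :
    δ * ((∫ z : Fin (n + 1) → ℝ, z 0 ^ 2 *
          (Real.exp (-(δ * (∑ i, z i ^ 2) / 2)) * Real.exp (-W z))) *
        (∫ z : Fin (n + 1) → ℝ, z 0 ^ 0 *
          (Real.exp (-(δ * (∑ i, z i ^ 2) / 2)) * Real.exp (-W z))) -
      (∫ z : Fin (n + 1) → ℝ, z 0 ^ 1 *
          (Real.exp (-(δ * (∑ i, z i ^ 2) / 2)) * Real.exp (-W z))) ^ 2) <
      (∫ z : Fin (n + 1) → ℝ, z 0 ^ 0 *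
          (Real.exp (-(δ * (∑ i, z i ^ 2) / 2)) * Real.exp (-W z))) ^ 2 := by
  simp only [integral_pow_mul_eq_marginal hc hi hδ]
  have hexp : ∀ s, (gaussianMarginal W δ s).toReal =
      Real.exp (-(-Real.log (gaussianMarginal W δ s).toReal)) := by
    intro s
    rw [neg_neg, Real.exp_log (ENNReal.toReal_pos (gaussianMarginal_ne_zero hc s)
      (gaussianMarginal_ne_top hW hc hi hδ s))]
  have hInt : Integrable fun s => (gaussianMarginal W δ s).toReal :=
    integrable_toReal_of_lintegral_ne_top (measurable_gaussianMarginal hc).aemeasurable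
      (lintegral_gaussianMarginal_lt_top hc hi hδ).ne
  have := variance_lt_real (convexOn_neg_log_gaussianMarginal hW hc hi hδ)
    (by simpa only [← hexp] using hInt) hδ
  simp only [← hexp] at this
  simpa using this

end Marginal

section Moment

variable {n : ℕ} {V : EuclideanSpace ℝ (Fin n) → ℝ} {δ : ℝ}

/-- The `k`-th moment in direction `u` about `c` of the reweighted measure
`exp (-δ ‖x - c‖ ^ 2 / 2) exp (-V x) dx`. -/
noncomputable def gaussianMoment {n : ℕ} (V : EuclideanSpace ℝ (Fin n) → ℝ) (k : ℕ)
    (δ : ℝ) (c u : EuclideanSpace ℝ (Fin n)) : ℝ :=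
  ∫ x, inner ℝ (x - c) u ^ k * (Real.exp (-(δ * ‖x - c‖ ^ 2 / 2)) * Real.exp (-V x))

theorem gaussianMoment_variance_lt (hV : ConvexOn ℝ Set.univ V) (hc : Continuous V)
    (hi : Integrable fun x => Real.exp (-V x)) (hδ : 0 < δ) (c : EuclideanSpace ℝ (Fin n))
    {u : EuclideanSpace ℝ (Fin n)} (hu : ‖u‖ = 1) :
    δ * (gaussianMoment V 2 δ c u * gaussianMoment V 0 δ c u - gaussianMoment V 1 δ c u ^ 2) <
      gaussianMoment V 0 δ c u ^ 2 := by
  rcases n with _ | n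
  · rw [Subsingleton.elim u 0, norm_zero] at hu
    exact absurd hu zero_ne_one
  obtain ⟨b, hb⟩ := Orthonormal.exists_orthonormalBasis_extension_of_card_eq (𝕜 := ℝ)
    (E := EuclideanSpace ℝ (Fin (n + 1))) (ι := Fin (n + 1)) (by simp)
    (v := fun _ => u) (s := {0}) (by
      refine ⟨fun _ => hu, fun i j hij => absurd (Subsingleton.elim i j) hij⟩)
  have hb0 : b 0 = u := hb 0 rfl
  set T : (Fin (n + 1) → ℝ) → EuclideanSpace ℝ (Fin (n + 1)) :=
    fun z => c + b.repr.symm (WithLp.toLp 2 z) with hT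
  have hTm : MeasurePreserving T volume volume :=
    (measurePreserving_add_left volume c).comp
      ((b.repr.symm.measurePreserving).comp (PiLp.volume_preserving_toLp (Fin (n + 1))))
  have hTc : Continuous T := by
    have := PiLp.continuous_toLp 2 (fun _ : Fin (n + 1) => ℝ)
    fun_prop
  have hTe : MeasurableEmbedding T :=
    (MeasurableEquiv.addLeft c).measurableEmbedding.comp
      (b.repr.symm.toHomeomorph.measurableEmbedding.comp
        (MeasurableEquiv.toLp 2 (Fin (n + 1) → ℝ)).measurableEmbedding)
  have hnorm : ∀ z, ‖T z - c‖ ^ 2 = ∑ i, z i ^ 2 := by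
    intro z
    simp [hT, EuclideanSpace.norm_sq_eq]
  have hinner : ∀ z, inner ℝ (T z - c) u = z 0 := by
    intro z
    have : b.repr (b.repr.symm (WithLp.toLp 2 z)) 0 = z 0 := by simp
    rw [b.repr_apply_apply, hb0, real_inner_comm] at this
    simpa [hT] using this
  have key := variance_coord_lt (W := fun z => V (T z)) (δ := δ) ?_ (hc.comp hTc)
    (hTm.integrable_comp_emb hTe |>.2 hi) hδ
  · have e : ∀ k, (∫ z : Fin (n + 1) → ℝ, z 0 ^ k *
        (Real.exp (-(δ * (∑ i, z i ^ 2) / 2)) * Real.exp (-V (T z)))) =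
        gaussianMoment V k δ c u := by
      intro k
      rw [gaussianMoment, ← hTm.integral_comp hTe]
      simp only [hnorm, hinner]
    simpa only [e] using key
  · refine ⟨convex_univ, fun x _ y _ a b' ha hb' hab => ?_⟩
    have : T (a • x + b' • y) = a • T x + b' • T y := by
      simp only [hT, WithLp.toLp_add, WithLp.toLp_smul, map_add, map_smul, smul_add]
      nth_rewrite 1 [← one_smul ℝ c, ← hab, add_smul]
      abel
    simp only [this]
    exact hV.2 (Set.mem_univ _) (Set.mem_univ _) ha hb' hab

theorem abs_inner_pow_mul_exp_le {E : Type*} [NormedAddCommGroup E] [InnerProductSpace ℝ E]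
    {ε R : ℝ} (hε : 0 < ε) (hδ : ε ≤ δ) (k : ℕ) (y : E) {u : E} (hu : ‖u‖ ≤ R)
    {r : ℝ} (hr : 0 ≤ r) :
    ‖inner ℝ y u ^ k * (Real.exp (-(δ * ‖y‖ ^ 2 / 2)) * r)‖ ≤
      R ^ k * (k.factorial * Real.exp (1 / (2 * ε))) * r := by
  have h1 : |inner ℝ y u| ≤ R * ‖y‖ :=
    (abs_real_inner_le_norm y u).trans (by rw [mul_comm]; gcongr)
  have hR : 0 ≤ R := (norm_nonneg u).trans hu
  rw [norm_mul, norm_pow, Real.norm_eq_abs, Real.norm_of_nonneg (by positivity), ← mul_assoc]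
  refine mul_le_mul_of_nonneg_right ?_ hr
  calc |inner ℝ y u| ^ k * Real.exp (-(δ * ‖y‖ ^ 2 / 2))
      ≤ (R * ‖y‖) ^ k * Real.exp (-(ε * ‖y‖ ^ 2 / 2)) := by gcongr
    _ = R ^ k * (‖y‖ ^ k * Real.exp (-(ε * ‖y‖ ^ 2 / 2))) := by rw [mul_pow, mul_assoc]
    _ ≤ _ := mul_le_mul_of_nonneg_left (pow_mul_exp_neg_sq_le hε k (norm_nonneg y)) (by positivity)

theorem integrable_inner_pow_mul (hc : Continuous V)
    (hi : Integrable fun x => Real.exp (-V x)) (hδ : 0 < δ) (k : ℕ)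
    (c u : EuclideanSpace ℝ (Fin n)) :
    Integrable fun x =>
      inner ℝ (x - c) u ^ k * (Real.exp (-(δ * ‖x - c‖ ^ 2 / 2)) * Real.exp (-V x)) := by
  refine (hi.const_mul _).mono' ?_ (Filter.Eventually.of_forall fun x =>
    abs_inner_pow_mul_exp_le hδ le_rfl k (x - c) le_rfl (Real.exp_nonneg _))
  exact Continuous.aestronglyMeasurable (by fun_prop)

theorem continuousAt_gaussianMoment (hc : Continuous V)
    (hi : Integrable fun x => Real.exp (-V x)) (k : ℕ)
    {p : ℝ × EuclideanSpace ℝ (Fin n) × EuclideanSpace ℝ (Fin n)} (hp : 0 < p.1) :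
    ContinuousAt (fun q : ℝ × EuclideanSpace ℝ (Fin n) × EuclideanSpace ℝ (Fin n) =>
      gaussianMoment V k q.1 q.2.1 q.2.2) p := by
  unfold gaussianMoment
  refine continuousAt_of_dominated (bound := fun x =>
    (‖p.2.2‖ + 1) ^ k * (k.factorial * Real.exp (1 / (2 * (p.1 / 2)))) * Real.exp (-V x))
    (Filter.Eventually.of_forall fun q => ?_) ?_ (hi.const_mul _)
    (Filter.Eventually.of_forall fun x => ?_)
  · exact Continuous.aestronglyMeasurable (by fun_prop)
  · have h1 : ∀ᶠ q in nhds p, p.1 / 2 < q.1 :=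
      continuousAt_fst.eventually (lt_mem_nhds (by linarith))
    have h2 : ∀ᶠ q in nhds p, ‖q.2.2‖ < ‖p.2.2‖ + 1 := by
      have : Continuous fun q : ℝ × EuclideanSpace ℝ (Fin n) × EuclideanSpace ℝ (Fin n) =>
        ‖q.2.2‖ := by fun_prop
      exact this.continuousAt.eventually (gt_mem_nhds (by linarith))
    filter_upwards [h1, h2] with q hq1 hq2
    exact Filter.Eventually.of_forall fun x =>
      abs_inner_pow_mul_exp_le (by linarith) hq1.le k (x - q.2.1) hq2.le (Real.exp_nonneg _)
  · exact Continuous.continuousAt (by fun_prop)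

theorem hasDerivAt_inner_pow_mul_exp {E : Type*} [NormedAddCommGroup E] [InnerProductSpace ℝ E]
    (δ r : ℝ) (k : ℕ) (y : E) {u : E} (hu : ‖u‖ = 1) (t : ℝ) :
    HasDerivAt (fun t : ℝ => inner ℝ (y - t • u) u ^ k *
        (Real.exp (-(δ * ‖y - t • u‖ ^ 2 / 2)) * r))
      (δ * (inner ℝ (y - t • u) u ^ (k + 1) * (Real.exp (-(δ * ‖y - t • u‖ ^ 2 / 2)) * r)) -
        k * (inner ℝ (y - t • u) u ^ (k - 1) *
          (Real.exp (-(δ * ‖y - t • u‖ ^ 2 / 2)) * r))) t := by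
  have huu : inner ℝ u u = (1 : ℝ) := by rw [real_inner_self_eq_norm_sq, hu, one_pow]
  have h1 : ∀ t : ℝ, inner ℝ (y - t • u) u = inner ℝ y u - t := by
    intro t
    rw [inner_sub_left, real_inner_smul_left, huu, mul_one]
  have h2 : ∀ t : ℝ, ‖y - t • u‖ ^ 2 = ‖y‖ ^ 2 - 2 * (t * inner ℝ y u) + t ^ 2 := by
    intro t
    rw [norm_sub_sq_real, real_inner_smul_right, norm_smul, hu, mul_one, Real.norm_eq_abs, sq_abs]
  simp only [h1, h2]
  have d1 : HasDerivAt (fun t : ℝ => inner ℝ y u - t) (-1) t :=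
    (hasDerivAt_id t).const_sub _
  have d2 : HasDerivAt (fun t : ℝ => -(δ * (‖y‖ ^ 2 - 2 * (t * inner ℝ y u) + t ^ 2) / 2))
      (δ * (inner ℝ y u - t)) t := by
    have a1 : HasDerivAt (fun t : ℝ => ‖y‖ ^ 2 - 2 * (t * inner ℝ y u) + t ^ 2)
        (-(2 * (1 * inner ℝ y u)) + 2 * t) t := by
      have := ((((hasDerivAt_id t).mul_const (inner ℝ y u)).const_mul 2).const_sub (‖y‖ ^ 2)).add
        (hasDerivAt_pow 2 t)
      exact this.congr_deriv (by simp)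
    exact ((a1.const_mul δ).div_const 2).neg.congr_deriv (by ring)
  refine ((d1.pow k).mul (d2.exp.mul_const r)).congr_deriv ?_
  rw [Pi.pow_apply]
  ring

theorem hasDerivAt_gaussianMoment (hc : Continuous V)
    (hi : Integrable fun x => Real.exp (-V x)) (hδ : 0 < δ) (k : ℕ)
    (c : EuclideanSpace ℝ (Fin n)) {u : EuclideanSpace ℝ (Fin n)} (hu : ‖u‖ = 1) (t : ℝ) :
    HasDerivAt (fun t : ℝ => gaussianMoment V k δ (c + t • u) u)
      (δ * gaussianMoment V (k + 1) δ (c + t • u) u -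
        k * gaussianMoment V (k - 1) δ (c + t • u) u) t := by
  have hb : ∀ (j : ℕ) (s : ℝ) (x : EuclideanSpace ℝ (Fin n)),
      ‖inner ℝ (x - c - s • u) u ^ j *
        (Real.exp (-(δ * ‖x - c - s • u‖ ^ 2 / 2)) * Real.exp (-V x))‖ ≤
      1 ^ j * (j.factorial * Real.exp (1 / (2 * δ))) * Real.exp (-V x) := fun j s x =>
    abs_inner_pow_mul_exp_le hδ le_rfl j _ hu.le (Real.exp_nonneg _)
  have hInt : ∀ j : ℕ, Integrable fun x => inner ℝ (x - c - t • u) u ^ j *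
      (Real.exp (-(δ * ‖x - c - t • u‖ ^ 2 / 2)) * Real.exp (-V x)) := by
    intro j
    simpa only [sub_sub] using integrable_inner_pow_mul hc hi hδ j (c + t • u) u
  have key := (hasDerivAt_integral_of_dominated_loc_of_deriv_le (μ := volume) (s := Set.univ)
    (x₀ := t) (bound := fun x =>
      δ * (1 ^ (k + 1) * ((k + 1).factorial * Real.exp (1 / (2 * δ))) * Real.exp (-V x)) +
      k * (1 ^ (k - 1) * ((k - 1).factorial * Real.exp (1 / (2 * δ))) * Real.exp (-V x)))
    Filter.univ_mem
    (Filter.Eventually.of_forall fun s => Continuous.aestronglyMeasurable (by fun_prop))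
    (hInt k) (Continuous.aestronglyMeasurable (by fun_prop))
    (Filter.Eventually.of_forall fun x s _ => ?_)
    (((hi.const_mul _).const_mul _).add ((hi.const_mul _).const_mul _))
    (Filter.Eventually.of_forall fun x s _ =>
      hasDerivAt_inner_pow_mul_exp δ (Real.exp (-V x)) k (x - c) hu s)).2
  · rw [integral_sub ((hInt _).const_mul _) ((hInt _).const_mul _), integral_const_mul,
      integral_const_mul] at key
    simpa only [gaussianMoment, ← sub_sub] using key
  · refine (norm_sub_le _ _).trans (add_le_add ?_ ?_)
    · rw [norm_mul, Real.norm_of_nonneg hδ.le]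
      exact mul_le_mul_of_nonneg_left (hb _ _ _) hδ.le
    · rw [norm_mul, Real.norm_of_nonneg (Nat.cast_nonneg k)]
      exact mul_le_mul_of_nonneg_left (hb _ _ _) (Nat.cast_nonneg k)

theorem gaussianMoment_zero_pos (hc : Continuous V)
    (hi : Integrable fun x => Real.exp (-V x)) (hδ : 0 < δ) (c u : EuclideanSpace ℝ (Fin n)) :
    0 < gaussianMoment V 0 δ c u := by
  have h := integrable_inner_pow_mul hc hi hδ 0 c u
  simp only [gaussianMoment, pow_zero, one_mul] at h ⊢
  refine (integral_pos_iff_support_of_nonneg (fun x => by positivity) h).2 ?_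
  have : (Function.support fun x : EuclideanSpace ℝ (Fin n) =>
      Real.exp (-(δ * ‖x - c‖ ^ 2 / 2)) * Real.exp (-V x)) = Set.univ := by
    ext x; simp [Real.exp_ne_zero]
  rw [this]
  exact isOpen_univ.measure_pos volume Set.univ_nonempty

theorem hasDerivAt_gaussianMoment_ratio (hc : Continuous V)
    (hi : Integrable fun x => Real.exp (-V x)) (hδ : 0 < δ)
    (c : EuclideanSpace ℝ (Fin n)) {u : EuclideanSpace ℝ (Fin n)} (hu : ‖u‖ = 1) (t : ℝ) :
    HasDerivAt (fun t : ℝ => gaussianMoment V 1 δ (c + t • u) u /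
        gaussianMoment V 0 δ (c + t • u) u)
      (-((gaussianMoment V 0 δ (c + t • u) u ^ 2 -
        δ * (gaussianMoment V 2 δ (c + t • u) u * gaussianMoment V 0 δ (c + t • u) u -
          gaussianMoment V 1 δ (c + t • u) u ^ 2)) /
        gaussianMoment V 0 δ (c + t • u) u ^ 2)) t := by
  have h0 := hasDerivAt_gaussianMoment hc hi hδ 0 c hu t
  have h1 := hasDerivAt_gaussianMoment hc hi hδ 1 c hu t
  refine (h1.div h0 (gaussianMoment_zero_pos hc hi hδ _ _).ne').congr_deriv ?_
  norm_num
  ring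

theorem abs_exp_neg_sub_exp_neg_le {a b m : ℝ} (ha : m ≤ a) (hb : m ≤ b) :
    |Real.exp (-a) - Real.exp (-b)| ≤ |a - b| * Real.exp (-m) := by
  wlog hab : a ≤ b generalizing a b
  · rw [abs_sub_comm, abs_sub_comm a b]
    exact this hb ha (le_of_not_ge hab)
  have h1 : Real.exp (-b) = Real.exp (-a) * Real.exp (a - b) := by
    rw [← Real.exp_add]; ring_nf
  have h2 := Real.add_one_le_exp (a - b)
  have h3 : Real.exp (-a) ≤ Real.exp (-m) := Real.exp_le_exp.2 (by linarith)
  rw [abs_of_nonneg (sub_nonneg.2 (Real.exp_le_exp.2 (by linarith))),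
    abs_of_nonpos (sub_nonpos.2 hab), h1]
  nlinarith [Real.exp_pos (-a)]

theorem abs_gaussianMoment_one_sub_le (hc : Continuous V)
    (hi : Integrable fun x => Real.exp (-V x)) {ε δ' : ℝ} (hε : 0 < ε) (hδ : ε ≤ δ) (hδ' : ε ≤ δ')
    (c : EuclideanSpace ℝ (Fin n)) {u : EuclideanSpace ℝ (Fin n)} (hu : ‖u‖ = 1) :
    |gaussianMoment V 1 δ c u - gaussianMoment V 1 δ' c u| ≤
      |δ - δ'| * (3 * Real.exp (1 / (2 * ε)) * ∫ x, Real.exp (-V x)) := by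
  rw [gaussianMoment, gaussianMoment,
    ← integral_sub (integrable_inner_pow_mul hc hi (hε.trans_le hδ) 1 c u)
      (integrable_inner_pow_mul hc hi (hε.trans_le hδ') 1 c u),
    ← integral_const_mul, ← integral_const_mul, ← Real.norm_eq_abs]
  refine norm_integral_le_of_norm_le ((hi.const_mul _).const_mul _)
    (Filter.Eventually.of_forall fun x => ?_)
  have h1 : |inner ℝ (x - c) u| ≤ ‖x - c‖ := by
    simpa [hu] using abs_real_inner_le_norm (x - c) u
  have h2 := abs_exp_neg_sub_exp_neg_le (a := δ * ‖x - c‖ ^ 2 / 2) (b := δ' * ‖x - c‖ ^ 2 / 2)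
    (m := ε * ‖x - c‖ ^ 2 / 2) (by gcongr) (by gcongr)
  have h3 := pow_mul_exp_neg_sq_le hε 3 (norm_nonneg (x - c))
  have h4 : δ * ‖x - c‖ ^ 2 / 2 - δ' * ‖x - c‖ ^ 2 / 2 = (δ - δ') * (‖x - c‖ ^ 2 / 2) := by ring
  rw [h4, abs_mul, abs_of_nonneg (a := ‖x - c‖ ^ 2 / 2) (by positivity)] at h2
  rw [pow_one, ← mul_sub, ← sub_mul, norm_mul, norm_mul, Real.norm_eq_abs, Real.norm_eq_abs,
    Real.norm_of_nonneg (Real.exp_nonneg _), ← mul_assoc, ← mul_assoc]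
  refine mul_le_mul_of_nonneg_right ?_ (Real.exp_nonneg _)
  calc _ ≤ ‖x - c‖ * (|δ - δ'| * (‖x - c‖ ^ 2 / 2) * Real.exp (-(ε * ‖x - c‖ ^ 2 / 2))) := by
        gcongr
    _ = |δ - δ'| * ((‖x - c‖ ^ 3 * Real.exp (-(ε * ‖x - c‖ ^ 2 / 2))) / 2) := by ring
    _ ≤ |δ - δ'| * (((3 : ℕ).factorial * Real.exp (1 / (2 * ε))) / 2) := by gcongr
    _ = _ := by
        rw [show ((3 : ℕ).factorial : ℝ) = 6 by norm_num [Nat.factorial]]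
        ring

theorem gaussianMoment_one_eq_zero (hc : Continuous V)
    (hi : Integrable fun x => Real.exp (-V x)) (hδ : 0 < δ) {c : EuclideanSpace ℝ (Fin n)}
    (h : (∫ x, (Real.exp (-(δ * ‖x - c‖ ^ 2 / 2)) * Real.exp (-V x)) • x) =
      (∫ x, Real.exp (-(δ * ‖x - c‖ ^ 2 / 2)) * Real.exp (-V x)) • c)
    (u : EuclideanSpace ℝ (Fin n)) : gaussianMoment V 1 δ c u = 0 := by
  have h0 : Integrable fun x => Real.exp (-(δ * ‖x - c‖ ^ 2 / 2)) * Real.exp (-V x) := by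
    simpa using integrable_inner_pow_mul hc hi hδ 0 c u
  have h1 : Integrable fun x =>
      (Real.exp (-(δ * ‖x - c‖ ^ 2 / 2)) * Real.exp (-V x)) • (x - c) := by
    refine (hi.const_mul ((1 : ℕ).factorial * Real.exp (1 / (2 * δ)))).mono'
      (Continuous.aestronglyMeasurable (by fun_prop)) (Filter.Eventually.of_forall fun x => ?_)
    have := pow_mul_exp_neg_sq_le hδ 1 (norm_nonneg (x - c))
    rw [norm_smul, Real.norm_of_nonneg (by positivity)]
    calc _ = (‖x - c‖ ^ 1 * Real.exp (-(δ * ‖x - c‖ ^ 2 / 2))) * Real.exp (-V x) := by ring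
      _ ≤ _ := by gcongr
  have h2 : (∫ x, (Real.exp (-(δ * ‖x - c‖ ^ 2 / 2)) * Real.exp (-V x)) • (x - c)) = 0 := by
    have e : (fun x => (Real.exp (-(δ * ‖x - c‖ ^ 2 / 2)) * Real.exp (-V x)) • x) = fun x =>
        (Real.exp (-(δ * ‖x - c‖ ^ 2 / 2)) * Real.exp (-V x)) • (x - c) +
        (Real.exp (-(δ * ‖x - c‖ ^ 2 / 2)) * Real.exp (-V x)) • c := by
      ext1 x
      rw [← smul_add, sub_add_cancel]
    rw [e, integral_add h1 (h0.smul_const c), integral_smul_const] at h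
    simpa using h
  have h3 := integral_inner (𝕜 := ℝ) h1 u
  rw [h2, inner_zero_right] at h3
  rw [gaussianMoment, ← h3]
  refine integral_congr_ae (Filter.Eventually.of_forall fun x => ?_)
  simp only [pow_one, real_inner_smul_right, real_inner_comm]
  ring

theorem exists_pos_le_of_compact_gaussianMoment (hV : ConvexOn ℝ Set.univ V) (hc : Continuous V)
    (hi : Integrable fun x => Real.exp (-V x))
    {S : Set (ℝ × EuclideanSpace ℝ (Fin n) × EuclideanSpace ℝ (Fin n))} (hS : IsCompact S)
    (hS0 : ∀ q ∈ S, 0 < q.1) (hS1 : ∀ q ∈ S, ‖q.2.2‖ = 1) :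
    ∃ κ > (0 : ℝ), ∀ q ∈ S, κ ≤ gaussianMoment V 0 q.1 q.2.1 q.2.2 ∧
      κ ≤ (gaussianMoment V 0 q.1 q.2.1 q.2.2 ^ 2 -
      q.1 * (gaussianMoment V 2 q.1 q.2.1 q.2.2 * gaussianMoment V 0 q.1 q.2.1 q.2.2 -
        gaussianMoment V 1 q.1 q.2.1 q.2.2 ^ 2)) / gaussianMoment V 0 q.1 q.2.1 q.2.2 ^ 2 := by
  have hcont : ∀ k, ContinuousOn
      (fun q : ℝ × EuclideanSpace ℝ (Fin n) × EuclideanSpace ℝ (Fin n) =>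
        gaussianMoment V k q.1 q.2.1 q.2.2) S :=
    fun k q hq => (continuousAt_gaussianMoment hc hi k (hS0 q hq)).continuousWithinAt
  have hpos : ∀ q ∈ S, 0 < gaussianMoment V 0 q.1 q.2.1 q.2.2 := fun q hq =>
    gaussianMoment_zero_pos hc hi (hS0 q hq) _ _
  have hvar : ∀ q ∈ S, 0 < gaussianMoment V 0 q.1 q.2.1 q.2.2 ^ 2 -
      q.1 * (gaussianMoment V 2 q.1 q.2.1 q.2.2 * gaussianMoment V 0 q.1 q.2.1 q.2.2 -
        gaussianMoment V 1 q.1 q.2.1 q.2.2 ^ 2) := fun q hq =>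
    sub_pos.2 (gaussianMoment_variance_lt hV hc hi (hS0 q hq) _ (hS1 q hq))
  have h0 := hcont 0
  have h1 := hcont 1
  have h2 := hcont 2
  generalize gaussianMoment V 0 = m0 at *
  generalize gaussianMoment V 1 = m1 at *
  generalize gaussianMoment V 2 = m2 at *
  obtain ⟨z, hz, hz'⟩ := hS.exists_forall_le' h0 hpos
  obtain ⟨κ, hκ, hκ'⟩ := hS.exists_forall_le' (a := 0)
    (((h0.pow 2).sub (continuousOn_fst.mul ((h2.mul h0).sub (h1.pow 2)))).div (h0.pow 2)
      fun q hq => (pow_pos (hpos q hq) 2).ne')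
    fun q hq => div_pos (hvar q hq) (pow_pos (hpos q hq) 2)
  exact ⟨min z κ, lt_min hz hκ, fun q hq =>
    ⟨(min_le_left _ _).trans (hz' q hq), (min_le_right _ _).trans (hκ' q hq)⟩⟩

theorem exists_pos_mul_min_le_gaussianMoment_one (hV : ConvexOn ℝ Set.univ V) (hc : Continuous V)
    (hi : Integrable fun x => Real.exp (-V x)) (hδ : 0 < δ) (c : EuclideanSpace ℝ (Fin n)) :
    ∃ κ > (0 : ℝ), ∀ δ' ∈ Set.Icc (δ / 2) (2 * δ), ∀ u : EuclideanSpace ℝ (Fin n), ‖u‖ = 1 →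
      ∀ d > (0 : ℝ), gaussianMoment V 1 δ' (c + d • u) u = 0 →
        κ * min d 1 ≤ gaussianMoment V 1 δ' c u := by
  obtain ⟨κ, hκ, hκ'⟩ := exists_pos_le_of_compact_gaussianMoment hV hc hi
    (S := Set.Icc (δ / 2) (2 * δ) ×ˢ
      (Metric.closedBall c 1 ×ˢ Metric.sphere (0 : EuclideanSpace ℝ (Fin n)) 1))
    (isCompact_Icc.prod ((isCompact_closedBall c 1).prod (isCompact_sphere 0 1)))
    (fun q hq => (half_pos hδ).trans_le hq.1.1) fun q hq => mem_sphere_zero_iff_norm.1 hq.2.2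
  refine ⟨κ * κ, mul_pos hκ hκ, fun δ' hδ' u hu d hd h => ?_⟩
  have hδ'0 : 0 < δ' := (half_pos hδ).trans_le hδ'.1
  have hder := hasDerivAt_gaussianMoment_ratio hc hi hδ'0 c hu
  have hs : 0 < min d 1 := lt_min hd one_pos
  have hanti := antitone_of_hasDerivAt_nonpos hder fun t =>
    neg_nonpos.2 (div_nonneg (sub_nonneg.2
      (gaussianMoment_variance_lt hV hc hi hδ'0 (c + t • u) hu).le) (sq_nonneg _))
  have h1 := hanti (min_le_left d 1)
  obtain ⟨t, ht, ht'⟩ := exists_hasDerivAt_eq_slope _ _ hs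
    (fun t _ => (hder t).continuousAt.continuousWithinAt) (fun t _ => hder t)
  have h2 := (hκ' (δ', c + t • u, u) ⟨hδ', by
    rw [mem_closedBall_iff_norm, add_sub_cancel_left, norm_smul, hu, mul_one,
      Real.norm_of_nonneg ht.1.le]
    exact ht.2.le.trans (min_le_right d 1), mem_sphere_zero_iff_norm.2 hu⟩).2
  have h3 := (hκ' (δ', c, u) ⟨hδ', Metric.mem_closedBall_self zero_le_one,
    mem_sphere_zero_iff_norm.2 hu⟩).1
  rw [eq_div_iff (by linarith)] at ht'
  simp only [h, zero_div, zero_smul, add_zero, sub_zero] at h1 h2 h3 ht'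
  have h4 : κ * min d 1 ≤ gaussianMoment V 1 δ' c u / gaussianMoment V 0 δ' c u := by
    nlinarith
  rw [le_div_iff₀ (hκ.trans_le h3)] at h4
  nlinarith [mul_pos hκ hs]

end Moment

theorem reweighted_barycenter_lipschitzAt {n : ℕ} {V : EuclideanSpace ℝ (Fin n) → ℝ}
    (hV : ConvexOn ℝ Set.univ V) (hi : Integrable fun x => Real.exp (-V x))
    {m : ℝ → EuclideanSpace ℝ (Fin n)}
    (hm : ∀ δ > (0 : ℝ),
      (∫ x, (Real.exp (-(δ * ‖x - m δ‖ ^ 2 / 2)) * Real.exp (-V x)) • x) =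
        (∫ x, Real.exp (-(δ * ‖x - m δ‖ ^ 2 / 2)) * Real.exp (-V x)) • m δ)
    {δ : ℝ} (hδ : 0 < δ) :
    ∃ U ∈ nhds δ, ∃ L : ℝ, ∀ δ' ∈ U, ‖m δ' - m δ‖ ≤ L * |δ' - δ| := by
  have hc : Continuous V := hV.locallyLipschitz.continuous
  obtain ⟨κ, hκ, hκ'⟩ := exists_pos_mul_min_le_gaussianMoment_one hV hc hi hδ (m δ)
  set M := 3 * Real.exp (1 / (2 * (δ / 2))) * ∫ x, Real.exp (-V x) with hM
  have hM0 : 0 ≤ M := by positivity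
  have hlim : ∀ᶠ δ' in nhds δ, M / κ * |δ' - δ| < 1 := by
    have : Continuous fun δ' : ℝ => M / κ * |δ' - δ| := by fun_prop
    exact this.continuousAt.eventually (gt_mem_nhds (by simp))
  refine ⟨_, Filter.inter_mem (Icc_mem_nhds (half_lt_self hδ) (by linarith : δ < 2 * δ)) hlim,
    M / κ, fun δ' hδ' => ?_⟩
  obtain ⟨hδ', hlt⟩ := hδ'
  rcases eq_or_ne (m δ') (m δ) with h | h
  · rw [h, sub_self, norm_zero]
    positivity
  have hd : 0 < ‖m δ' - m δ‖ := norm_pos_iff.2 (sub_ne_zero.2 h)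
  set u := ‖m δ' - m δ‖⁻¹ • (m δ' - m δ) with hu
  have hu1 : ‖u‖ = 1 := norm_smul_inv_norm (𝕜 := ℝ) (sub_ne_zero.2 h)
  have hmu : m δ + ‖m δ' - m δ‖ • u = m δ' := by
    rw [hu, smul_inv_smul₀ hd.ne', add_sub_cancel]
  have h0 := gaussianMoment_one_eq_zero hc hi hδ (hm δ hδ) u
  have h1 := hκ' δ' hδ' u hu1 _ hd (by
    rw [hmu]
    exact gaussianMoment_one_eq_zero hc hi ((half_pos hδ).trans_le hδ'.1)
      (hm δ' ((half_pos hδ).trans_le hδ'.1)) u)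
  have h2 := abs_gaussianMoment_one_sub_le hc hi (half_pos hδ) hδ'.1 (half_le_self hδ.le)
    (m δ) hu1
  rw [h0, sub_zero, ← hM] at h2
  have h3 : min ‖m δ' - m δ‖ 1 ≤ M / κ * |δ' - δ| := by
    rw [div_mul_eq_mul_div, le_div_iff₀' hκ, mul_comm M]
    exact h1.trans ((le_abs_self _).trans h2)
  rcases min_le_iff.1 h3 with h4 | h4
  · exact h4
  · exact absurd hlt (not_lt.2 h4)

/-- **Continuity (local Lipschitz continuity) of `δ ↦ m_δ`.**
For a log-concave probability density `ρ = e^{-V}` on `ℝⁿ`, let `m δ` be (for each `δ > 0`)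
the unique fixed point of the reweighted barycenter map. Then `δ ↦ m δ` is continuous on
`(0,∞)`, and for each `δ > 0` there are a neighborhood `U` of `δ` and `L < ∞` with
`|m δ' - m δ| ≤ L |δ' - δ|` for all `δ' ∈ U`. -/
theorem reweighted_barycenter_continuous
    {n : ℕ} (V : EuclideanSpace ℝ (Fin n) → ℝ) (hV : ConvexOn ℝ Set.univ V)
    (hρ : (∫ x, Real.exp (-V x)) = 1)
    (m : ℝ → EuclideanSpace ℝ (Fin n))
    (hm : ∀ δ > (0 : ℝ),
      (∫ x, (Real.exp (-(δ * ‖x - m δ‖ ^ 2 / 2)) * Real.exp (-V x)) • x) =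
        (∫ x, Real.exp (-(δ * ‖x - m δ‖ ^ 2 / 2)) * Real.exp (-V x)) • m δ) :
    ContinuousOn m (Set.Ioi 0) ∧
      ∀ δ > (0 : ℝ), ∃ U ∈ nhds δ, ∃ L : ℝ,
        ∀ δ' ∈ U, ‖m δ' - m δ‖ ≤ L * |δ' - δ| := by
  have hi : Integrable fun x => Real.exp (-V x) := by
    by_contra h
    rw [integral_undef h] at hρ
    exact zero_ne_one hρ
  refine ⟨fun δ hδ => ?_, fun δ hδ => reweighted_barycenter_lipschitzAt hV hi hm hδ⟩
  obtain ⟨U, hU, L, hL⟩ := reweighted_barycenter_lipschitzAt hV hi hm hδ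
  refine ContinuousAt.continuousWithinAt (tendsto_iff_norm_sub_tendsto_zero.2 ?_)
  refine squeeze_zero' (Filter.Eventually.of_forall fun _ => norm_nonneg _)
    (Filter.mem_of_superset hU hL) ?_
  have : Continuous fun δ' : ℝ => L * |δ' - δ| := by fun_prop
  simpa using this.tendsto δ
end
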